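/- Let s ≥ 1/2 and T > 0. Suppose v and w are both solutions of the renormalized mKdV system (∗) on [0,T] in C([0,T];H^s) and v(0) = w(0). Then v(t) = w(t) for every t ∈ [0,T] (unconditional uniqueness of periodic mKdV in H^s). -/

import Mathlib

open scoped ENNReal

/-- Japanese bracket `⟨k⟩ = 1 + |k|`. -/
noncomputable def jb (k : ℤ) : ℝ := 1 + |(k : ℝ)|

/-- `‖f‖_{H^s} = (∑_k ⟨k⟩^{2s} |f k|²)^{1/2}`, valued in `[0,∞]`. -/
noncomputable def hnorm (s : ℝ) (f : ℤ → ℂ) : ℝ≥0∞ :=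
  (∑' k : ℤ, ENNReal.ofReal (jb k ^ (2 * s) * ‖f k‖ ^ 2)) ^ (1 / 2 : ℝ)

/-- `Φ(k̄) = k³ − k₁³ − k₂³ − k₃³` with `k = k₁ + k₂ + k₃`. -/
def Phi (k₁ k₂ k₃ : ℤ) : ℤ := (k₁ + k₂ + k₃) ^ 3 - k₁ ^ 3 - k₂ ^ 3 - k₃ ^ 3

/-- Summand of the non-resonant part, parametrized by `(k₁, k₂)` with `k₃ = k - k₁ - k₂`. -/
noncomputable def ntermF (v : ℤ → ℂ) (t : ℝ) (k : ℤ) (p : ℤ × ℤ) : ℂ :=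
  if Phi p.1 p.2 (k - p.1 - p.2) ≠ 0 then
    (k : ℂ) * Complex.exp (Complex.I * (t : ℂ) * ((Phi p.1 p.2 (k - p.1 - p.2) : ℤ) : ℂ)) *
      v p.1 * v p.2 * v (k - p.1 - p.2)
  else 0

/-- Non-resonant part `N(v)(t)_k`. -/
noncomputable def Nonres (v : ℤ → ℂ) (t : ℝ) (k : ℤ) : ℂ :=
  Complex.I / 3 * ∑' p : ℤ × ℤ, ntermF v t k p

/-- Resonant part `R(v)_k = -i k |v_k|² v_k`. -/
noncomputable def Res (v : ℤ → ℂ) (k : ℤ) : ℂ :=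
  -Complex.I * (k : ℂ) * (‖v k‖ : ℂ) ^ 2 * v k

/-- `v` is a solution of the renormalized mKdV system (∗) on `[0,T]` in `C([0,T];H^s)`. -/
structure IsSolution (s T : ℝ) (v : ℝ → ℤ → ℂ) : Prop where
  finite : ∀ t ∈ Set.Icc (0 : ℝ) T, hnorm s (v t) < ⊤
  cont : ∀ t ∈ Set.Icc (0 : ℝ) T, ∀ ε > (0 : ℝ), ∃ δ > (0 : ℝ),
    ∀ t' ∈ Set.Icc (0 : ℝ) T, |t' - t| < δ →
      hnorm s (fun k => v t' k - v t k) < ENNReal.ofReal ε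
  abs_summable : ∀ t ∈ Set.Icc (0 : ℝ) T, ∀ k : ℤ,
    Summable (fun p : ℤ × ℤ => ‖ntermF (v t) t k p‖)
  eqn : ∀ t ∈ Set.Icc (0 : ℝ) T, ∀ k : ℤ,
    HasDerivWithinAt (fun τ => v τ k) (Nonres (v t) t k + Res (v t) k) (Set.Icc (0 : ℝ) T) t

theorem one_le_jb (k : ℤ) : 1 ≤ jb k := by
  unfold jb; linarith [abs_nonneg (k : ℝ)]

theorem jb_pos (k : ℤ) : 0 < jb k := lt_of_lt_of_le one_pos (one_le_jb k)

theorem sum_mul_le_of_injOn {ι α β : Type*} {F : α → ℝ} {G : β → ℝ} {c d : ℝ}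
    (hF0 : ∀ a, 0 ≤ F a) (hG0 : ∀ b, 0 ≤ G b)
    (hF : ∀ S : Finset α, ∑ a ∈ S, F a ≤ c) (hG : ∀ S : Finset β, ∑ b ∈ S, G b ≤ d)
    (A : Finset ι) {x : ι → α} {y : ι → β} (hinj : Set.InjOn (fun i => (x i, y i)) A) :
    ∑ i ∈ A, F (x i) * G (y i) ≤ c * d := by
  classical
  calc ∑ i ∈ A, F (x i) * G (y i)
      = ∑ q ∈ A.image (fun i => (x i, y i)), F q.1 * G q.2 :=
        (Finset.sum_image (f := fun q : α × β => F q.1 * G q.2) hinj).symm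
    _ ≤ ∑ q ∈ (A.image x) ×ˢ (A.image y), F q.1 * G q.2 := by
        apply Finset.sum_le_sum_of_subset_of_nonneg
        · intro q hq
          obtain ⟨i, hi, rfl⟩ := Finset.mem_image.1 hq
          exact Finset.mem_product.2
            ⟨Finset.mem_image_of_mem _ hi, Finset.mem_image_of_mem _ hi⟩
        · intro q _ _
          exact mul_nonneg (hF0 _) (hG0 _)
    _ = (∑ a ∈ A.image x, F a) * ∑ b ∈ A.image y, G b := by
        rw [Finset.sum_product, Finset.sum_mul_sum]
    _ ≤ c * d := mul_le_mul (hF _) (hG _) (Finset.sum_nonneg fun _ _ => hG0 _)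
        (le_trans (by simp) (hF ∅))

theorem exists_sum_jb_rpow_le {r : ℝ} (hr : 1 < r) :
    ∃ c : ℝ, 0 < c ∧ ∀ S : Finset ℤ, ∑ k ∈ S, jb k ^ (-r) ≤ c := by
  have hs : Summable fun n : ℤ => 1 / |(n : ℝ) + 1 / 2| ^ r :=
    (Real.summable_one_div_int_add_rpow (1 / 2) r).2 hr
  have hle : ∀ k : ℤ, jb k ^ (-r) ≤ 1 / |(k : ℝ) + 1 / 2| ^ r := by
    intro k
    have h0 : 0 < |(k : ℝ) + 1 / 2| := by
      rw [abs_pos]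
      intro h
      have : (2 * k + 1 : ℤ) = 0 := by
        have : (2 * (k : ℝ) + 1) = 0 := by linarith
        exact_mod_cast this
      omega
    have h1 : |(k : ℝ) + 1 / 2| ≤ jb k := by
      unfold jb
      refine (abs_add_le _ _).trans ?_
      rw [abs_of_pos (by norm_num : (0 : ℝ) < 1 / 2)]
      linarith
    rw [Real.rpow_neg (jb_pos k).le, ← one_div]
    exact one_div_le_one_div_of_le (Real.rpow_pos_of_pos h0 _)
      (Real.rpow_le_rpow h0.le h1 (by linarith))
  have hnn : ∀ k : ℤ, 0 ≤ 1 / |(k : ℝ) + 1 / 2| ^ r := fun k => by positivity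
  refine ⟨∑' n : ℤ, 1 / |(n : ℝ) + 1 / 2| ^ r + 1,
    add_pos_of_nonneg_of_pos (tsum_nonneg hnn) one_pos, fun S => ?_⟩
  have := hs.sum_le_tsum S fun k _ => hnn k
  linarith [Finset.sum_le_sum fun k (_ : k ∈ S) => hle k]

theorem sum_one_div_jb_le {R : ℝ} (hR : 1 ≤ R) (S : Finset ℤ) (hS : ∀ k ∈ S, jb k ≤ R) :
    ∑ k ∈ S, 1 / jb k ≤ 2 * (1 + Real.log R) := by
  classical
  have key : ∀ S' : Finset ℤ, (∀ k ∈ S', jb k ≤ R) → Set.InjOn (fun k : ℤ => k.natAbs + 1) S' →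
      ∑ k ∈ S', 1 / jb k ≤ 1 + Real.log R := by
    intro S' hS' hinj
    calc ∑ k ∈ S', 1 / jb k = ∑ k ∈ S', ((((k.natAbs + 1 : ℕ) : ℝ))⁻¹) := by
          refine Finset.sum_congr rfl fun k _ => ?_
          rw [one_div, jb]
          push_cast
          rw [Nat.cast_natAbs, Int.cast_abs, add_comm]
      _ = ∑ m ∈ S'.image (fun k : ℤ => k.natAbs + 1), ((m : ℝ))⁻¹ :=
          (Finset.sum_image (f := fun m : ℕ => ((m : ℝ))⁻¹) hinj).symm
      _ ≤ ∑ m ∈ Finset.Icc 1 ⌊R⌋₊, ((m : ℝ))⁻¹ := by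
          apply Finset.sum_le_sum_of_subset_of_nonneg
          · intro m hm
            obtain ⟨k, hk, rfl⟩ := Finset.mem_image.1 hm
            refine Finset.mem_Icc.2 ⟨by omega, Nat.le_floor ?_⟩
            have := hS' k hk
            rw [jb] at this
            push_cast
            rw [Nat.cast_natAbs, Int.cast_abs]
            linarith
          · intro m _ _
            positivity
      _ = (harmonic ⌊R⌋₊ : ℝ) := by
          rw [harmonic_eq_sum_Icc]
          push_cast
          rfl
      _ ≤ 1 + Real.log R := harmonic_floor_le_one_add_log R hR
  have h1 := key (S.filter fun k => 0 ≤ k) (fun k hk => hS k (Finset.mem_filter.1 hk).1) (by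
    intro i hi j hj h
    have hi' := (Finset.mem_filter.1 hi).2
    have hj' := (Finset.mem_filter.1 hj).2
    simp only at h
    omega)
  have h2 := key (S.filter fun k => ¬ 0 ≤ k) (fun k hk => hS k (Finset.mem_filter.1 hk).1) (by
    intro i hi j hj h
    have hi' := (Finset.mem_filter.1 hi).2
    have hj' := (Finset.mem_filter.1 hj).2
    simp only at h
    omega)
  rw [← Finset.sum_filter_add_sum_filter_not S fun k => 0 ≤ k]
  linarith

/-- `f` is a nonnegative sequence with `∑ ⟨k⟩ f(k)² ≤ M²`. -/
def HalfBound (M : ℝ) (f : ℤ → ℝ) : Prop :=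
  (∀ k, 0 ≤ f k) ∧ ∀ S : Finset ℤ, ∑ k ∈ S, jb k * f k ^ 2 ≤ M ^ 2

theorem HalfBound.jb_mul_sq_le {M : ℝ} {f : ℤ → ℝ} (h : HalfBound M f) (k : ℤ) :
    jb k * f k ^ 2 ≤ M ^ 2 := by
  simpa using h.2 {k}

theorem HalfBound.le {M : ℝ} {f : ℤ → ℝ} (hM : 0 ≤ M) (h : HalfBound M f) (k : ℤ) :
    f k ≤ M := by
  refine abs_le_of_sq_le_sq' ?_ hM |>.2
  nlinarith [h.jb_mul_sq_le k, one_le_jb k, sq_nonneg (f k)]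

theorem HalfBound.add {F G : ℝ} {f g : ℤ → ℝ} (hF : 0 ≤ F) (hG : 0 ≤ G)
    (hf : HalfBound F f) (hg : HalfBound G g) :
    HalfBound (2 * (F + G)) fun k => f k + g k := by
  refine ⟨fun k => add_nonneg (hf.1 k) (hg.1 k), fun S => ?_⟩
  have : ∑ k ∈ S, jb k * (f k + g k) ^ 2 ≤
      ∑ k ∈ S, (2 * (jb k * f k ^ 2) + 2 * (jb k * g k ^ 2)) := by
    refine Finset.sum_le_sum fun k _ => ?_
    nlinarith [mul_nonneg (jb_pos k).le (sq_nonneg (f k - g k))]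
  rw [Finset.sum_add_distrib, ← Finset.mul_sum, ← Finset.mul_sum] at this
  nlinarith [hf.2 S, hg.2 S, mul_nonneg hF hG]

theorem HalfBound.const_mul {F c : ℝ} {f : ℤ → ℝ} (hc : 0 ≤ c) (hf : HalfBound F f) :
    HalfBound (c * F) fun k => c * f k := by
  refine ⟨fun k => mul_nonneg hc (hf.1 k), fun S => ?_⟩
  have : ∑ k ∈ S, jb k * (c * f k) ^ 2 = c ^ 2 * ∑ k ∈ S, jb k * f k ^ 2 := by
    rw [Finset.mul_sum]
    exact Finset.sum_congr rfl fun k _ => by ring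
  rw [this, mul_pow]
  exact mul_le_mul_of_nonneg_left (hf.2 S) (sq_nonneg c)

theorem symbol_sq_aux_third {k₁ k₂ k₃ a b c k α β γ x y : ℝ}
    (ha : a = k₁ + k₂) (hb : b = k₂ + k₃) (hc : c = k₁ + k₃) (hk : k = k₁ + k₂ + k₃)
    (hα : α ^ 2 * a ^ 2 = 1) (hβ : β ^ 2 * b ^ 2 = 1) (hγ : γ ^ 2 * c ^ 2 = 1)
    (hx : x * (1 + |k₁|) = 1) (hy : y * (1 + |k₂|) = 1) (hx0 : 0 < x) (hy0 : 0 < y) :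
    (k * k₃) ^ 2 * (α ^ 2 * β ^ 2 * γ ^ 2) * (x * y) ≤
      α ^ 2 * x ^ 2 + α ^ 2 * y ^ 2 + β ^ 2 * γ ^ 2 + γ ^ 2 * α ^ 2 + α ^ 2 * β ^ 2 := by
  have h1 : (k * k₃) ^ 2 ≤ 2 * (b * c) ^ 2 + 2 * (k₁ * k₂) ^ 2 := by
    have : k * k₃ = b * c - k₁ * k₂ := by subst_vars; ring
    rw [this]
    nlinarith [sq_nonneg (b * c + k₁ * k₂)]
  have hx1 : k₁ ^ 2 * x ≤ |k₁| := by
    rw [← sq_abs]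
    nlinarith [abs_nonneg k₁]
  have hy1 : k₂ ^ 2 * y ≤ |k₂| := by
    rw [← sq_abs]
    nlinarith [abs_nonneg k₂]
  have h2 : |k₁| * |k₂| ≤ (a ^ 2 + b ^ 2 + c ^ 2) / 2 := by
    rw [← abs_mul, abs_le]
    subst_vars
    constructor <;> nlinarith [sq_nonneg (k₁ + k₂), sq_nonneg (k₁ - k₂), sq_nonneg (k₁ + k₃),
      sq_nonneg (k₂ + k₃), sq_nonneg (k₁ + k₂ + 2 * k₃), sq_nonneg (k₁ - k₂)]
  have h3 : (k₁ * k₂) ^ 2 * (x * y) ≤ (a ^ 2 + b ^ 2 + c ^ 2) / 2 := by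
    calc (k₁ * k₂) ^ 2 * (x * y) = (k₁ ^ 2 * x) * (k₂ ^ 2 * y) := by ring
      _ ≤ |k₁| * |k₂| := mul_le_mul hx1 hy1 (by positivity) (abs_nonneg _)
      _ ≤ _ := h2
  have h4 : (k * k₃) ^ 2 * (x * y) ≤ 2 * (b * c) ^ 2 * (x * y) + (a ^ 2 + b ^ 2 + c ^ 2) := by
    have := mul_le_mul_of_nonneg_right h1 (mul_pos hx0 hy0).le
    nlinarith
  have h5 := mul_le_mul_of_nonneg_left h4 (by positivity : 0 ≤ α ^ 2 * β ^ 2 * γ ^ 2)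
  have h6 : α ^ 2 * β ^ 2 * γ ^ 2 * (2 * (b * c) ^ 2 * (x * y) + (a ^ 2 + b ^ 2 + c ^ 2))
      = 2 * α ^ 2 * (x * y) + (β ^ 2 * γ ^ 2 + γ ^ 2 * α ^ 2 + α ^ 2 * β ^ 2) := by
    linear_combination 2 * α ^ 2 * (x * y) * (γ ^ 2 * c ^ 2) * hβ + 2 * α ^ 2 * (x * y) * hγ +
      β ^ 2 * γ ^ 2 * hα + α ^ 2 * γ ^ 2 * hβ + α ^ 2 * β ^ 2 * hγ
  nlinarith [mul_nonneg (sq_nonneg α) (sq_nonneg (x - y))]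

theorem symbol_sq_aux_first {k₁ k₂ k₃ a b c k α β γ x y : ℝ}
    (ha : a = k₁ + k₂) (hb : b = k₂ + k₃) (hc : c = k₁ + k₃) (hk : k = k₁ + k₂ + k₃)
    (hα : α * |a| = 1) (hβ : β * |b| = 1) (hγ : γ * |c| = 1)
    (hx : x * (1 + |k₁|) = 1) (hy : y * (1 + |k₂|) = 1) (hx0 : 0 < x) (hy0 : 0 < y)
    (hα0 : 0 < α) (hβ0 : 0 < β) (hγ0 : 0 < γ) :
    (k * k₁) ^ 2 * (α ^ 2 * β ^ 2 * γ ^ 2) * (x * y) ≤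
      2 * (β ^ 2 * γ ^ 2 + γ ^ 2 * α ^ 2 + 2 * (α ^ 2 * β ^ 2) + β ^ 2 * y ^ 2 + α ^ 2 * y ^ 2) := by
  have hx1 : k₁ ^ 2 * x ≤ |k₁| := by
    rw [← sq_abs]
    nlinarith [abs_nonneg k₁]
  have hk2 : |k₂| * y ≤ 1 := by nlinarith [abs_nonneg k₂]
  have hky : |k| * y ≤ 1 + |c| * y := by
    have : |k| ≤ |c| + |k₂| := by
      have : k = c + k₂ := by subst_vars; ring
      rw [this]
      exact abs_add_le _ _
    nlinarith
  have hcy : |c| * y ≤ (|a| + |b|) * y + 2 := by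
    have : |c| ≤ |a| + |b| + 2 * |k₂| := by
      have : c = a + b - 2 * k₂ := by subst_vars; ring
      rw [this]
      refine (abs_sub _ _).trans ?_
      rw [abs_mul, abs_two]
      linarith [abs_add_le a b]
    nlinarith
  have hkk : |k| * |k₁| ≤ (|a| ^ 2 + |b| ^ 2 + |c| ^ 2) / 2 := by
    rw [← abs_mul, abs_le, sq_abs, sq_abs, sq_abs]
    subst_vars
    constructor <;> nlinarith [sq_nonneg (2 * k₁ + k₂ + k₃), sq_nonneg (k₂ + k₃),
      sq_nonneg (k₁ + k₂), sq_nonneg (k₁ + k₃), sq_nonneg (k₂ - k₃)]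
  have h1 : (k * k₁) ^ 2 * (x * y) ≤ (|a| ^ 2 + |b| ^ 2 + |c| ^ 2) / 2 * (1 + |c| * y) := by
    calc (k * k₁) ^ 2 * (x * y) = (k₁ ^ 2 * x) * (|k| * (|k| * y)) := by
          rw [mul_pow, ← sq_abs k]; ring
      _ ≤ |k₁| * (|k| * (1 + |c| * y)) := by gcongr
      _ = |k| * |k₁| * (1 + |c| * y) := by ring
      _ ≤ _ := by gcongr
  have h2 := mul_le_mul_of_nonneg_left h1 (by positivity : 0 ≤ α ^ 2 * β ^ 2 * γ ^ 2)
  generalize |a| = A at *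
  generalize |b| = B at *
  generalize |c| = D at *
  have h3 : α ^ 2 * β ^ 2 * γ ^ 2 * ((A ^ 2 + B ^ 2 + D ^ 2) / 2 * (1 + D * y)) =
      (β ^ 2 * γ ^ 2 + γ ^ 2 * α ^ 2 + α ^ 2 * β ^ 2) / 2 +
      (β ^ 2 * γ * y + α ^ 2 * γ * y + α ^ 2 * β ^ 2 * (D * y)) / 2 := by
    have hα2 : α ^ 2 * A ^ 2 = 1 := by rw [← mul_pow, hα, one_pow]
    have hβ2 : β ^ 2 * B ^ 2 = 1 := by rw [← mul_pow, hβ, one_pow]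
    have hγ2 : γ ^ 2 * D ^ 2 = 1 := by rw [← mul_pow, hγ, one_pow]
    linear_combination (1 + D * y) / 2 * (β ^ 2 * γ ^ 2 * hα2 + α ^ 2 * γ ^ 2 * hβ2 +
      α ^ 2 * β ^ 2 * hγ2) + (β ^ 2 * γ * y + α ^ 2 * γ * y) / 2 * hγ
  have h4 : α ^ 2 * β ^ 2 * (D * y) ≤ α * β ^ 2 * y + α ^ 2 * β * y + 2 * (α ^ 2 * β ^ 2) := by
    have h := mul_le_mul_of_nonneg_left hcy (by positivity : 0 ≤ α ^ 2 * β ^ 2)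
    have : α ^ 2 * β ^ 2 * ((A + B) * y + 2) =
        α * β ^ 2 * y + α ^ 2 * β * y + 2 * (α ^ 2 * β ^ 2) := by
      linear_combination α * β ^ 2 * y * hα + α ^ 2 * β * y * hβ
    linarith
  have e1 := mul_nonneg (sq_nonneg β) (sq_nonneg (γ - y))
  have e2 := mul_nonneg (sq_nonneg α) (sq_nonneg (γ - y))
  have e3 := mul_nonneg (sq_nonneg β) (sq_nonneg (α - y))
  have e4 := mul_nonneg (sq_nonneg α) (sq_nonneg (β - y))
  have e5 : 0 ≤ β ^ 2 * γ ^ 2 := by positivity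
  have e6 : 0 ≤ α ^ 2 * γ ^ 2 := by positivity
  have e7 : 0 ≤ α ^ 2 * β ^ 2 := by positivity
  have e8 : 0 ≤ β ^ 2 * y ^ 2 := by positivity
  have e9 : 0 ≤ α ^ 2 * y ^ 2 := by positivity
  nlinarith

theorem Phi_eq (k₁ k₂ k₃ : ℤ) : Phi k₁ k₂ k₃ = 3 * ((k₁ + k₂) * (k₂ + k₃) * (k₁ + k₃)) := by
  unfold Phi; ring

/-- The weight `|k| (|k₁| + |k₂| + |k₃|) / |Φ|`. -/
noncomputable def symb (k : ℤ) (p : ℤ × ℤ) : ℝ :=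
  |(k : ℝ)| * (|(p.1 : ℝ)| + |(p.2 : ℝ)| + |((k - p.1 - p.2 : ℤ) : ℝ)|) /
    |((Phi p.1 p.2 (k - p.1 - p.2) : ℤ) : ℝ)|

theorem symb_nonneg (k : ℤ) (p : ℤ × ℤ) : 0 ≤ symb k p := by
  unfold symb; positivity

theorem inv_jb_sq_le (n : ℤ) : (1 / jb n) ^ 2 ≤ jb n ^ (-(5 / 4) : ℝ) := by
  have : (1 / jb n) ^ 2 = jb n ^ (-2 : ℝ) := by
    rw [Real.rpow_neg (jb_pos n).le, one_div, inv_pow]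
    norm_cast
  rw [this]
  exact Real.rpow_le_rpow_of_exponent_le (one_le_jb n) (by norm_num)

theorem inv_abs_sq_le {n : ℤ} (hn : n ≠ 0) :
    (1 / |(n : ℝ)|) ^ 2 ≤ 4 * jb n ^ (-(5 / 4) : ℝ) := by
  have h1 : 1 ≤ |(n : ℝ)| := by exact_mod_cast Int.one_le_abs hn
  have h2 : 1 / |(n : ℝ)| ≤ 2 * (1 / jb n) := by
    rw [mul_one_div, div_le_div_iff₀ (by linarith) (jb_pos n), jb]
    linarith
  calc (1 / |(n : ℝ)|) ^ 2 ≤ (2 * (1 / jb n)) ^ 2 := by gcongr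
    _ = 4 * (1 / jb n) ^ 2 := by ring
    _ ≤ _ := by gcongr; exact inv_jb_sq_le n

theorem symb_sq_div_le (k : ℤ) (p : ℤ × ℤ) (hp : Phi p.1 p.2 (k - p.1 - p.2) ≠ 0)
    {Q : ℤ → ℝ} (hQ : Q = fun n => jb n ^ (-(5 / 4) : ℝ)) :
    symb k p ^ 2 / (jb p.1 * jb p.2) ≤
      40 * (Q (p.1 + p.2) * Q p.1 + Q (p.1 + p.2) * Q p.2 + Q (k - p.1) * Q (k - p.2) +
        Q (k - p.2) * Q (p.1 + p.2) + Q (p.1 + p.2) * Q (k - p.1) + Q (k - p.1) * Q p.2 +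
        Q (k - p.2) * Q p.1) := by
  obtain ⟨k₁, k₂⟩ := p
  simp only at hp ⊢
  rw [Phi_eq] at hp
  have ha : k₁ + k₂ ≠ 0 := by rintro h; simp [h] at hp
  have hb : k - k₁ ≠ 0 := by
    rintro h; apply hp; rw [show k₂ + (k - k₁ - k₂) = k - k₁ by ring, h]; ring
  have hc : k - k₂ ≠ 0 := by
    rintro h; apply hp; rw [show k₁ + (k - k₁ - k₂) = k - k₂ by ring, h]; ring
  have hα := inv_abs_sq_le ha
  have hβ := inv_abs_sq_le hb
  have hγ := inv_abs_sq_le hc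
  have hx := inv_jb_sq_le k₁
  have hy := inv_jb_sq_le k₂
  have hQ' : ∀ n, jb n ^ (-(5 / 4) : ℝ) = Q n := fun n => by rw [hQ]
  have hQ0 : ∀ n, 0 ≤ Q n := fun n => by rw [← hQ']; exact Real.rpow_nonneg (jb_pos n).le _
  rw [hQ'] at hα hβ hγ hx hy
  have ha' : |((k₁ + k₂ : ℤ) : ℝ)| ≠ 0 := by rw [abs_ne_zero]; exact_mod_cast ha
  have hb' : |((k - k₁ : ℤ) : ℝ)| ≠ 0 := by rw [abs_ne_zero]; exact_mod_cast hb
  have hc' : |((k - k₂ : ℤ) : ℝ)| ≠ 0 := by rw [abs_ne_zero]; exact_mod_cast hc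
  have hα0 : 0 < 1 / |((k₁ + k₂ : ℤ) : ℝ)| := by positivity
  have hβ0 : 0 < 1 / |((k - k₁ : ℤ) : ℝ)| := by positivity
  have hγ0 : 0 < 1 / |((k - k₂ : ℤ) : ℝ)| := by positivity
  have hx0 : 0 < 1 / jb k₁ := one_div_pos.2 (jb_pos _)
  have hy0 : 0 < 1 / jb k₂ := one_div_pos.2 (jb_pos _)
  have hα1 := one_div_mul_cancel ha'
  have hβ1 := one_div_mul_cancel hb'
  have hγ1 := one_div_mul_cancel hc'
  have hx1 : 1 / jb k₁ * (1 + |(k₁ : ℝ)|) = 1 := one_div_mul_cancel (jb_pos k₁).ne'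
  have hy1 : 1 / jb k₂ * (1 + |(k₂ : ℝ)|) = 1 := one_div_mul_cancel (jb_pos k₂).ne'
  have hsymb : symb k (k₁, k₂) ^ 2 / (jb k₁ * jb k₂) =
      ((k : ℝ) ^ 2 * (|(k₁ : ℝ)| + |(k₂ : ℝ)| + |((k - k₁ - k₂ : ℤ) : ℝ)|) ^ 2) / 9 *
      ((1 / |((k₁ + k₂ : ℤ) : ℝ)|) ^ 2 * (1 / |((k - k₁ : ℤ) : ℝ)|) ^ 2 *
        (1 / |((k - k₂ : ℤ) : ℝ)|) ^ 2) * (1 / jb k₁ * (1 / jb k₂)) := by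
    unfold symb
    simp only
    rw [Phi_eq, show k₂ + (k - k₁ - k₂) = k - k₁ by ring,
      show k₁ + (k - k₁ - k₂) = k - k₂ by ring, Int.cast_mul, Int.cast_mul, Int.cast_mul,
      abs_mul, abs_mul, abs_mul, ← sq_abs (k : ℝ)]
    have := (jb_pos k₁).ne'
    have := (jb_pos k₂).ne'
    rw [show |((3 : ℤ) : ℝ)| = 3 by norm_num]
    field_simp
    ring
  rw [hsymb]
  generalize 1 / |((k₁ + k₂ : ℤ) : ℝ)| = α at *
  generalize 1 / |((k - k₁ : ℤ) : ℝ)| = β at *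
  generalize 1 / |((k - k₂ : ℤ) : ℝ)| = γ at *
  generalize 1 / jb k₁ = x at *
  generalize 1 / jb k₂ = y at *
  have hα2 : α ^ 2 * ((k₁ + k₂ : ℤ) : ℝ) ^ 2 = 1 := by
    rw [← sq_abs ((k₁ + k₂ : ℤ) : ℝ), ← mul_pow, hα1, one_pow]
  have hβ2 : β ^ 2 * ((k - k₁ : ℤ) : ℝ) ^ 2 = 1 := by
    rw [← sq_abs ((k - k₁ : ℤ) : ℝ), ← mul_pow, hβ1, one_pow]
  have hγ2 : γ ^ 2 * ((k - k₂ : ℤ) : ℝ) ^ 2 = 1 := by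
    rw [← sq_abs ((k - k₂ : ℤ) : ℝ), ← mul_pow, hγ1, one_pow]
  have h3 := symbol_sq_aux_third (k₁ := k₁) (k₂ := k₂) (k₃ := ((k - k₁ - k₂ : ℤ) : ℝ))
    (a := ((k₁ + k₂ : ℤ) : ℝ)) (b := ((k - k₁ : ℤ) : ℝ)) (c := ((k - k₂ : ℤ) : ℝ)) (k := k)
    (by push_cast; ring) (by push_cast; ring) (by push_cast; ring) (by push_cast; ring)
    hα2 hβ2 hγ2 hx1 hy1 hx0 hy0
  have h1 := symbol_sq_aux_first (k₁ := k₁) (k₂ := k₂) (k₃ := ((k - k₁ - k₂ : ℤ) : ℝ))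
    (a := ((k₁ + k₂ : ℤ) : ℝ)) (b := ((k - k₁ : ℤ) : ℝ)) (c := ((k - k₂ : ℤ) : ℝ)) (k := k)
    (by push_cast; ring) (by push_cast; ring) (by push_cast; ring) (by push_cast; ring)
    hα1 hβ1 hγ1 hx1 hy1 hx0 hy0 hα0 hβ0 hγ0
  have h2 := symbol_sq_aux_first (k₁ := k₂) (k₂ := k₁) (k₃ := ((k - k₁ - k₂ : ℤ) : ℝ))
    (a := ((k₁ + k₂ : ℤ) : ℝ)) (b := ((k - k₂ : ℤ) : ℝ)) (c := ((k - k₁ : ℤ) : ℝ)) (k := k)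
    (by push_cast; ring) (by push_cast; ring) (by push_cast; ring) (by push_cast; ring)
    hα1 hγ1 hβ1 hy1 hx1 hy0 hx0 hα0 hγ0 hβ0
  have hs : (|(k₁ : ℝ)| + |(k₂ : ℝ)| + |((k - k₁ - k₂ : ℤ) : ℝ)|) ^ 2 ≤
      3 * ((k₁ : ℝ) ^ 2 + (k₂ : ℝ) ^ 2 + ((k - k₁ - k₂ : ℤ) : ℝ) ^ 2) := by
    rw [← sq_abs (k₁ : ℝ), ← sq_abs (k₂ : ℝ), ← sq_abs ((k - k₁ - k₂ : ℤ) : ℝ)]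
    nlinarith [sq_nonneg (|(k₁ : ℝ)| - |(k₂ : ℝ)|),
      sq_nonneg (|(k₁ : ℝ)| - |((k - k₁ - k₂ : ℤ) : ℝ)|),
      sq_nonneg (|(k₂ : ℝ)| - |((k - k₁ - k₂ : ℤ) : ℝ)|)]
  have hmain : ((k : ℝ) ^ 2 * (|(k₁ : ℝ)| + |(k₂ : ℝ)| + |((k - k₁ - k₂ : ℤ) : ℝ)|) ^ 2) / 9 *
      (α ^ 2 * β ^ 2 * γ ^ 2) * (x * y) ≤
      ((k * k₁ : ℝ) ^ 2 * (α ^ 2 * β ^ 2 * γ ^ 2) * (x * y) +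
      (k * k₂ : ℝ) ^ 2 * (α ^ 2 * γ ^ 2 * β ^ 2) * (y * x) +
      (k * ((k - k₁ - k₂ : ℤ) : ℝ)) ^ 2 * (α ^ 2 * β ^ 2 * γ ^ 2) * (x * y)) / 3 := by
    generalize |(k₁ : ℝ)| + |(k₂ : ℝ)| + |((k - k₁ - k₂ : ℤ) : ℝ)| = s at hs ⊢
    generalize ((k - k₁ - k₂ : ℤ) : ℝ) = r at hs ⊢
    have := mul_le_mul_of_nonneg_left hs
      (by positivity : 0 ≤ (k : ℝ) ^ 2 * (α ^ 2 * β ^ 2 * γ ^ 2) * (x * y))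
    linarith
  refine hmain.trans ?_
  have m : ∀ {u v U V : ℝ}, u ^ 2 ≤ 4 * U → v ^ 2 ≤ 4 * V → 0 ≤ U → 0 ≤ V →
      u ^ 2 * v ^ 2 ≤ 16 * (U * V) := by
    intro u v U V h h' hU hV
    have := mul_le_mul h h' (sq_nonneg v) (by linarith)
    linarith
  have hx' : x ^ 2 ≤ 4 * Q k₁ := by linarith [hQ0 k₁]
  have hy' : y ^ 2 ≤ 4 * Q k₂ := by linarith [hQ0 k₂]
  have m1 := m hα hx' (hQ0 _) (hQ0 _)
  have m2 := m hα hy' (hQ0 _) (hQ0 _)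
  have m3 := m hβ hγ (hQ0 _) (hQ0 _)
  have m4 := m hγ hα (hQ0 _) (hQ0 _)
  have m5 := m hα hβ (hQ0 _) (hQ0 _)
  have m6 := m hβ hy' (hQ0 _) (hQ0 _)
  have m7 := m hγ hx' (hQ0 _) (hQ0 _)
  have n1 := mul_nonneg (hQ0 (k₁ + k₂)) (hQ0 k₁)
  have n2 := mul_nonneg (hQ0 (k₁ + k₂)) (hQ0 k₂)
  have n3 := mul_nonneg (hQ0 (k - k₁)) (hQ0 (k - k₂))
  have n4 := mul_nonneg (hQ0 (k - k₂)) (hQ0 (k₁ + k₂))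
  have n5 := mul_nonneg (hQ0 (k₁ + k₂)) (hQ0 (k - k₁))
  have n6 := mul_nonneg (hQ0 (k - k₁)) (hQ0 k₂)
  have n7 := mul_nonneg (hQ0 (k - k₂)) (hQ0 k₁)
  linarith [mul_comm (β ^ 2) (γ ^ 2), mul_comm (α ^ 2) (γ ^ 2), mul_comm (α ^ 2) (β ^ 2)]

theorem exists_sum_symb_sq_le : ∃ C : ℝ, 0 < C ∧ ∀ (k : ℤ) (A : Finset (ℤ × ℤ)),
    (∀ p ∈ A, Phi p.1 p.2 (k - p.1 - p.2) ≠ 0) →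
    ∑ p ∈ A, symb k p ^ 2 / (jb p.1 * jb p.2) ≤ C := by
  obtain ⟨c, hc0, hc⟩ := exists_sum_jb_rpow_le (r := 5 / 4) (by norm_num)
  refine ⟨280 * (c * c), by positivity, fun k A hA => ?_⟩
  obtain ⟨Q, hQ⟩ : ∃ Q : ℤ → ℝ, Q = fun n => jb n ^ (-(5 / 4) : ℝ) := ⟨_, rfl⟩
  have hQ0 : ∀ n, 0 ≤ Q n := fun n => by rw [hQ]; exact Real.rpow_nonneg (jb_pos n).le _
  have hQc : ∀ S : Finset ℤ, ∑ n ∈ S, Q n ≤ c := by rw [hQ]; exact hc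
  have key : ∀ x y : ℤ × ℤ → ℤ, Function.Injective (fun p => (x p, y p)) →
      ∑ p ∈ A, Q (x p) * Q (y p) ≤ c * c := fun x y h =>
    sum_mul_le_of_injOn hQ0 hQ0 hQc hQc A h.injOn
  have i1 := key (fun p => p.1 + p.2) (fun p => p.1) (by
    rintro ⟨a, b⟩ ⟨a', b'⟩ h; simp only [Prod.mk.injEq] at h ⊢; omega)
  have i2 := key (fun p => p.1 + p.2) (fun p => p.2) (by
    rintro ⟨a, b⟩ ⟨a', b'⟩ h; simp only [Prod.mk.injEq] at h ⊢; omega)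
  have i3 := key (fun p => k - p.1) (fun p => k - p.2) (by
    rintro ⟨a, b⟩ ⟨a', b'⟩ h; simp only [Prod.mk.injEq] at h ⊢; omega)
  have i4 := key (fun p => k - p.2) (fun p => p.1 + p.2) (by
    rintro ⟨a, b⟩ ⟨a', b'⟩ h; simp only [Prod.mk.injEq] at h ⊢; omega)
  have i5 := key (fun p => p.1 + p.2) (fun p => k - p.1) (by
    rintro ⟨a, b⟩ ⟨a', b'⟩ h; simp only [Prod.mk.injEq] at h ⊢; omega)
  have i6 := key (fun p => k - p.1) (fun p => p.2) (by
    rintro ⟨a, b⟩ ⟨a', b'⟩ h; simp only [Prod.mk.injEq] at h ⊢; omega)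
  have i7 := key (fun p => k - p.2) (fun p => p.1) (by
    rintro ⟨a, b⟩ ⟨a', b'⟩ h; simp only [Prod.mk.injEq] at h ⊢; omega)
  refine (Finset.sum_le_sum fun p hp => symb_sq_div_le k p (hA p hp) hQ).trans ?_
  rw [← Finset.mul_sum]
  simp only [Finset.sum_add_distrib]
  linarith

theorem symb_swap (k : ℤ) (p : ℤ × ℤ) : symb k (p.1, k - p.1 - p.2) = symb k p := by
  unfold symb
  simp only
  rw [show k - p.1 - (k - p.1 - p.2) = p.2 by ring,
    show Phi p.1 (k - p.1 - p.2) p.2 = Phi p.1 p.2 (k - p.1 - p.2) by simp only [Phi_eq]; ring]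
  ring

theorem symb_rotate (k : ℤ) (p : ℤ × ℤ) : symb k (p.2, k - p.1 - p.2) = symb k p := by
  unfold symb
  simp only
  rw [show k - p.2 - (k - p.1 - p.2) = p.1 by ring,
    show Phi p.2 (k - p.1 - p.2) p.1 = Phi p.1 p.2 (k - p.1 - p.2) by simp only [Phi_eq]; ring]
  ring

/-- Bilinear estimates with the weight `symb`, for any two of the three frequencies. -/
theorem exists_sum_symb_mul_le : ∃ C : ℝ, 0 < C ∧ ∀ (k : ℤ) (A : Finset (ℤ × ℤ)),
    (∀ p ∈ A, Phi p.1 p.2 (k - p.1 - p.2) ≠ 0) →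
    ∀ (f g : ℤ → ℝ) (F G : ℝ), 0 ≤ F → 0 ≤ G → HalfBound F f → HalfBound G g →
    ∑ p ∈ A, symb k p * (f p.1 * g p.2) ≤ C * (F * G) ∧
    ∑ p ∈ A, symb k p * (f p.1 * g (k - p.1 - p.2)) ≤ C * (F * G) ∧
    ∑ p ∈ A, symb k p * (f p.2 * g (k - p.1 - p.2)) ≤ C * (F * G) := by
  classical
  obtain ⟨C, hC0, hC⟩ := exists_sum_symb_sq_le
  refine ⟨√C, Real.sqrt_pos.2 hC0, fun k A hA f g F G hF hG hf hg => ?_⟩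
  have key : ∀ B : Finset (ℤ × ℤ), (∀ p ∈ B, Phi p.1 p.2 (k - p.1 - p.2) ≠ 0) →
      ∑ p ∈ B, symb k p * (f p.1 * g p.2) ≤ √C * (F * G) := by
    intro B hB
    have h1 : ∑ p ∈ B, symb k p * (f p.1 * g p.2) =
        ∑ p ∈ B, symb k p / √(jb p.1 * jb p.2) * (√(jb p.1 * jb p.2) * (f p.1 * g p.2)) := by
      refine Finset.sum_congr rfl fun p _ => ?_
      have : √(jb p.1 * jb p.2) ≠ 0 :=
        (Real.sqrt_pos.2 (mul_pos (jb_pos _) (jb_pos _))).ne'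
      field_simp
    rw [h1]
    refine (Real.sum_mul_le_sqrt_mul_sqrt B _ _).trans ?_
    refine mul_le_mul (Real.sqrt_le_sqrt ?_) ?_ (Real.sqrt_nonneg _) (Real.sqrt_nonneg _)
    · refine le_trans (le_of_eq ?_) (hC k B hB)
      refine Finset.sum_congr rfl fun p _ => ?_
      rw [div_pow, Real.sq_sqrt (mul_pos (jb_pos _) (jb_pos _)).le]
    · refine Real.sqrt_le_iff.2 ⟨mul_nonneg hF hG, ?_⟩
      rw [mul_pow]
      refine le_trans (le_of_eq ?_) (sum_mul_le_of_injOn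
        (F := fun n => jb n * f n ^ 2) (G := fun n => jb n * g n ^ 2)
        (fun n => mul_nonneg (jb_pos n).le (sq_nonneg _))
        (fun n => mul_nonneg (jb_pos n).le (sq_nonneg _)) hf.2 hg.2 B
        (x := fun p => p.1) (y := fun p => p.2) (fun p _ q _ h => h))
      refine Finset.sum_congr rfl fun p _ => ?_
      rw [mul_pow, Real.sq_sqrt (mul_pos (jb_pos _) (jb_pos _)).le]
      ring
  refine ⟨key A hA, ?_, ?_⟩
  · have hinj : Set.InjOn (fun p : ℤ × ℤ => (p.1, k - p.1 - p.2)) A := by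
      rintro ⟨a, b⟩ _ ⟨a', b'⟩ _ h; simp only [Prod.mk.injEq] at h ⊢; omega
    have h := key (A.image fun p => (p.1, k - p.1 - p.2)) (by
      intro q hq
      obtain ⟨p, hp, rfl⟩ := Finset.mem_image.1 hq
      have := hA p hp
      simp only [Phi_eq] at this ⊢
      convert this using 1
      ring)
    rw [Finset.sum_image hinj] at h
    simpa only [symb_swap] using h
  · have hinj : Set.InjOn (fun p : ℤ × ℤ => (p.2, k - p.1 - p.2)) A := by
      rintro ⟨a, b⟩ _ ⟨a', b'⟩ _ h; simp only [Prod.mk.injEq] at h ⊢; omega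
    have h := key (A.image fun p => (p.2, k - p.1 - p.2)) (by
      intro q hq
      obtain ⟨p, hp, rfl⟩ := Finset.mem_image.1 hq
      have := hA p hp
      simp only [Phi_eq] at this ⊢
      convert this using 1
      ring)
    rw [Finset.sum_image hinj] at h
    simpa only [symb_rotate] using h

theorem exists_sum_triple_tail_le : ∃ C : ℝ, 0 < C ∧ ∀ (k : ℤ) (B : Finset (ℤ × ℤ))
    (f : ℤ → ℝ) (M R : ℝ), 0 ≤ M → 0 < R → HalfBound M f →
    (∀ p ∈ B, R ≤ jb p.1 * jb p.2 * jb (k - p.1 - p.2)) →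
    ∑ p ∈ B, f p.1 * f p.2 * f (k - p.1 - p.2) ≤ C * M ^ 3 * R ^ (-(1 / 12) : ℝ) := by
  obtain ⟨c, hc0, hc⟩ := exists_sum_jb_rpow_le (r := 5 / 4) (by norm_num)
  refine ⟨√(c * c), Real.sqrt_pos.2 (mul_pos hc0 hc0), fun k B f M R hM hR hf hB => ?_⟩
  obtain ⟨P, hP⟩ : ∃ P : ℤ → ℝ, P = fun n => jb n ^ (-(5 / 12) : ℝ) := ⟨_, rfl⟩
  obtain ⟨h, hh⟩ : ∃ h : ℤ → ℝ, h = fun n => √(jb n) * f n := ⟨_, rfl⟩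
  have hP0 : ∀ n, 0 ≤ P n := fun n => by rw [hP]; exact Real.rpow_nonneg (jb_pos n).le _
  have hh0 : ∀ n, 0 ≤ h n := fun n => by
    rw [hh]; exact mul_nonneg (Real.sqrt_nonneg _) (hf.1 n)
  have hhsq : ∀ n, h n ^ 2 = jb n * f n ^ 2 := fun n => by
    rw [hh]; simp only; rw [mul_pow, Real.sq_sqrt (jb_pos n).le]
  have hhM : ∀ n, h n ≤ M := fun n => by
    refine abs_le_of_sq_le_sq' ?_ hM |>.2
    rw [hhsq]
    exact hf.jb_mul_sq_le n
  have hP3 : ∀ n, P n ^ 3 = jb n ^ (-(5 / 4) : ℝ) := fun n => by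
    rw [hP]
    simp only
    rw [← Real.rpow_natCast, ← Real.rpow_mul (jb_pos n).le]
    norm_num
  have hfac : ∀ n, f n = P n * h n * jb n ^ (-(1 / 12) : ℝ) := fun n => by
    rw [hP, hh]
    simp only
    rw [Real.sqrt_eq_rpow]
    have : jb n ^ (-(5 / 12) : ℝ) * jb n ^ (1 / 2 : ℝ) * jb n ^ (-(1 / 12) : ℝ) = 1 := by
      rw [← Real.rpow_add (jb_pos n), ← Real.rpow_add (jb_pos n)]
      norm_num
    linear_combination (-f n) * this
  have hterm : ∀ p ∈ B, f p.1 * f p.2 * f (k - p.1 - p.2) ≤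
      M * R ^ (-(1 / 12) : ℝ) * ((P p.1 * P p.2 * P (k - p.1 - p.2)) * (h p.1 * h p.2)) := by
    intro p hp
    have hJ : (jb p.1 * jb p.2 * jb (k - p.1 - p.2)) ^ (-(1 / 12) : ℝ) ≤ R ^ (-(1 / 12) : ℝ) :=
      Real.rpow_le_rpow_of_nonpos hR (hB p hp) (by norm_num)
    rw [Real.mul_rpow (mul_pos (jb_pos _) (jb_pos _)).le (jb_pos _).le,
      Real.mul_rpow (jb_pos _).le (jb_pos _).le] at hJ
    have hw : 0 ≤ (P p.1 * P p.2 * P (k - p.1 - p.2)) * (h p.1 * h p.2) :=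
      mul_nonneg (mul_nonneg (mul_nonneg (hP0 _) (hP0 _)) (hP0 _)) (mul_nonneg (hh0 _) (hh0 _))
    calc f p.1 * f p.2 * f (k - p.1 - p.2)
        = (h (k - p.1 - p.2) * (jb p.1 ^ (-(1 / 12) : ℝ) * jb p.2 ^ (-(1 / 12) : ℝ) *
          jb (k - p.1 - p.2) ^ (-(1 / 12) : ℝ))) *
          ((P p.1 * P p.2 * P (k - p.1 - p.2)) * (h p.1 * h p.2)) := by
          rw [hfac p.1, hfac p.2, hfac (k - p.1 - p.2)]; ring
      _ ≤ _ := mul_le_mul_of_nonneg_right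
          (mul_le_mul (hhM _) hJ (by
            have := fun n => Real.rpow_nonneg (jb_pos n).le (-(1 / 12))
            exact mul_nonneg (mul_nonneg (this _) (this _)) (this _)) hM) hw
  refine (Finset.sum_le_sum hterm).trans ?_
  rw [← Finset.mul_sum]
  have hQ0 : ∀ n, 0 ≤ P n ^ 3 := fun n => pow_nonneg (hP0 n) 3
  have hQc : ∀ S : Finset ℤ, ∑ n ∈ S, P n ^ 3 ≤ c := fun S => by
    simp only [hP3]; exact hc S
  have key : ∀ x y : ℤ × ℤ → ℤ, Function.Injective (fun p => (x p, y p)) →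
      ∑ p ∈ B, P (x p) ^ 3 * P (y p) ^ 3 ≤ c * c := fun x y h =>
    sum_mul_le_of_injOn hQ0 hQ0 hQc hQc B h.injOn
  have i1 := key (fun p => p.1) (fun p => p.2) (fun p q h => h)
  have i2 := key (fun p => p.2) (fun p => k - p.1 - p.2) (by
    rintro ⟨a, b⟩ ⟨a', b'⟩ h; simp only [Prod.mk.injEq] at h ⊢; omega)
  have i3 := key (fun p => k - p.1 - p.2) (fun p => p.1) (by
    rintro ⟨a, b⟩ ⟨a', b'⟩ h; simp only [Prod.mk.injEq] at h ⊢; omega)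
  have hPP : ∑ p ∈ B, (P p.1 * P p.2 * P (k - p.1 - p.2)) ^ 2 ≤ c * c := by
    have : ∀ p ∈ B, (P p.1 * P p.2 * P (k - p.1 - p.2)) ^ 2 ≤
        (P p.1 ^ 3 * P p.2 ^ 3 + P p.2 ^ 3 * P (k - p.1 - p.2) ^ 3 +
          P (k - p.1 - p.2) ^ 3 * P p.1 ^ 3) / 3 := by
      intro p _
      have amgm : ∀ u v w : ℝ, 0 ≤ u → 0 ≤ v → 0 ≤ w →
          u * v * w ≤ (u ^ 3 + v ^ 3 + w ^ 3) / 3 := fun u v w hu hv hw => by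
        nlinarith [mul_nonneg (add_nonneg (add_nonneg hu hv) hw) (add_nonneg (add_nonneg
          (sq_nonneg (u - v)) (sq_nonneg (v - w))) (sq_nonneg (w - u)))]
      have := amgm (P p.1 * P p.2) (P p.2 * P (k - p.1 - p.2)) (P (k - p.1 - p.2) * P p.1)
        (mul_nonneg (hP0 _) (hP0 _)) (mul_nonneg (hP0 _) (hP0 _)) (mul_nonneg (hP0 _) (hP0 _))
      linarith
    refine (Finset.sum_le_sum this).trans ?_
    rw [← Finset.sum_div, Finset.sum_add_distrib, Finset.sum_add_distrib]
    linarith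
  have hhh : ∑ p ∈ B, (h p.1 * h p.2) ^ 2 ≤ M ^ 2 * M ^ 2 := by
    simp only [mul_pow, hhsq]
    exact sum_mul_le_of_injOn (F := fun n => jb n * f n ^ 2) (G := fun n => jb n * f n ^ 2)
        (fun n => mul_nonneg (jb_pos n).le (sq_nonneg _))
        (fun n => mul_nonneg (jb_pos n).le (sq_nonneg _)) hf.2 hf.2 B
        (x := fun p => p.1) (y := fun p => p.2) (fun p _ q _ h => h)
  have hcs := (Real.sum_mul_le_sqrt_mul_sqrt B (fun p => P p.1 * P p.2 * P (k - p.1 - p.2))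
    (fun p => h p.1 * h p.2)).trans (mul_le_mul (Real.sqrt_le_sqrt hPP) (Real.sqrt_le_sqrt hhh)
      (Real.sqrt_nonneg _) (Real.sqrt_nonneg _))
  have hMM : √(M ^ 2 * M ^ 2) = M ^ 2 := Real.sqrt_mul_self (sq_nonneg M)
  rw [hMM] at hcs
  calc _ ≤ M * R ^ (-(1 / 12) : ℝ) * (√(c * c) * M ^ 2) :=
        mul_le_mul_of_nonneg_left hcs (mul_nonneg hM (Real.rpow_nonneg hR.le _))
    _ = _ := by ring

/-- Restriction of a sequence to the frequencies with `⟨k⟩ ≤ R`. -/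
noncomputable def cutoff (R : ℝ) (f : ℤ → ℝ) (k : ℤ) : ℝ := if jb k ≤ R then f k else 0

theorem cutoff_nonneg {R : ℝ} {f : ℤ → ℝ} (hf : ∀ k, 0 ≤ f k) (k : ℤ) : 0 ≤ cutoff R f k := by
  unfold cutoff; split_ifs
  exacts [hf k, le_rfl]

theorem cutoff_of_le {R : ℝ} {f : ℤ → ℝ} {k : ℤ} (h : jb k ≤ R) : cutoff R f k = f k :=
  if_pos h

theorem HalfBound.cutoff {M : ℝ} {f : ℤ → ℝ} (hf : HalfBound M f) (R : ℝ) :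
    HalfBound M (cutoff R f) := by
  refine ⟨cutoff_nonneg hf.1, fun S => (Finset.sum_le_sum fun k _ => ?_).trans (hf.2 S)⟩
  refine mul_le_mul_of_nonneg_left ?_ (jb_pos k).le
  unfold _root_.cutoff
  split_ifs
  · exact le_rfl
  · simpa using sq_nonneg (f k)

theorem HalfBound.sum_cutoff_le {M R : ℝ} {f : ℤ → ℝ} (hM : 0 ≤ M) (hf : HalfBound M f)
    (hR : 1 ≤ R) (S : Finset ℤ) :
    ∑ k ∈ S, _root_.cutoff R f k ≤ M * √(2 * (1 + Real.log R)) := by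
  classical
  unfold _root_.cutoff
  rw [← Finset.sum_filter]
  have h1 : ∑ k ∈ S.filter (fun k => jb k ≤ R), f k =
      ∑ k ∈ S.filter (fun k => jb k ≤ R), (√(jb k) * f k) * (1 / √(jb k)) := by
    refine Finset.sum_congr rfl fun k _ => ?_
    have := (Real.sqrt_pos.2 (jb_pos k)).ne'
    field_simp
  rw [h1]
  refine (Real.sum_mul_le_sqrt_mul_sqrt _ _ _).trans ?_
  refine mul_le_mul ?_ (Real.sqrt_le_sqrt ?_) (Real.sqrt_nonneg _) hM
  · refine Real.sqrt_le_iff.2 ⟨hM, ?_⟩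
    simp only [mul_pow, Real.sq_sqrt (jb_pos _).le]
    exact hf.2 _
  · simp only [div_pow, Real.sq_sqrt (jb_pos _).le, one_pow]
    exact sum_one_div_jb_le hR _ fun k hk => (Finset.mem_filter.1 hk).2

theorem sum_sq_sum_triple_le {U : ℤ → ℝ} {M s : ℝ} (hs : 0 ≤ s) (hU : HalfBound M U)
    (hUs : ∀ S : Finset ℤ, ∑ k ∈ S, U k ≤ s) (P : Finset (ℤ × ℤ)) (S : Finset ℤ)
    (x y z : ℤ → ℤ × ℤ → ℤ) (hyz : ∀ k, Function.Injective fun p => (y k p, z k p))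
    (hxyz : Function.Injective fun q : ℤ × (ℤ × ℤ) => (x q.1 q.2, (y q.1 q.2, z q.1 q.2))) :
    ∑ k ∈ S, (∑ p ∈ P, √(jb (x k p)) * U (x k p) * U (y k p) * U (z k p)) ^ 2 ≤
      M ^ 2 * s ^ 4 := by
  have hU0 := hU.1
  have hpair : ∀ T : Finset (ℤ × ℤ), ∑ q ∈ T, U q.1 * U q.2 ≤ s * s := fun T =>
    sum_mul_le_of_injOn hU0 hU0 hUs hUs T (x := fun p => p.1) (y := fun p => p.2)
      (fun p _ q _ h => h)
  have h1 : ∀ k ∈ S, (∑ p ∈ P, √(jb (x k p)) * U (x k p) * U (y k p) * U (z k p)) ^ 2 ≤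
      (s * s) * ∑ p ∈ P, (jb (x k p) * U (x k p) ^ 2) * (U (y k p) * U (z k p)) := by
    intro k _
    have hcs := Finset.sum_sq_le_sum_mul_sum_of_sq_le_mul P
      (r := fun p => √(jb (x k p)) * U (x k p) * U (y k p) * U (z k p))
      (f := fun p => U (y k p) * U (z k p))
      (g := fun p => (jb (x k p) * U (x k p) ^ 2) * (U (y k p) * U (z k p)))
      (fun p _ => mul_nonneg (hU0 _) (hU0 _))
      (fun p _ => mul_nonneg (mul_nonneg (jb_pos _).le (sq_nonneg _))
        (mul_nonneg (hU0 _) (hU0 _)))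
      (fun p _ => le_of_eq <| by
        simp only [mul_pow, Real.sq_sqrt (jb_pos _).le]; ring)
    refine hcs.trans (mul_le_mul_of_nonneg_right ?_ ?_)
    · exact sum_mul_le_of_injOn hU0 hU0 hUs hUs P (hyz k).injOn
    · exact Finset.sum_nonneg fun p _ => mul_nonneg (mul_nonneg (jb_pos _).le (sq_nonneg _))
        (mul_nonneg (hU0 _) (hU0 _))
  refine (Finset.sum_le_sum h1).trans ?_
  rw [← Finset.mul_sum, ← Finset.sum_product'
    (f := fun k p => (jb (x k p) * U (x k p) ^ 2) * (U (y k p) * U (z k p)))]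
  have h2 := sum_mul_le_of_injOn (F := fun n => jb n * U n ^ 2)
    (G := fun q : ℤ × ℤ => U q.1 * U q.2)
    (fun n => mul_nonneg (jb_pos n).le (sq_nonneg _)) (fun q => mul_nonneg (hU0 _) (hU0 _))
    hU.2 hpair (S ×ˢ P) hxyz.injOn
  calc _ ≤ s * s * (M ^ 2 * (s * s)) := mul_le_mul_of_nonneg_left h2 (mul_nonneg hs hs)
    _ = _ := by ring

theorem jb_add_le (k : ℤ) (p : ℤ × ℤ) :
    √(jb k) ≤ √(jb p.1) + √(jb p.2) + √(jb (k - p.1 - p.2)) := by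
  have h : jb k ≤ jb p.1 + jb p.2 + jb (k - p.1 - p.2) := by
    unfold jb
    have h1 := abs_add_three (p.1 : ℝ) (p.2 : ℝ) ((k - p.1 - p.2 : ℤ) : ℝ)
    have h2 : (p.1 : ℝ) + (p.2 : ℝ) + ((k - p.1 - p.2 : ℤ) : ℝ) = k := by push_cast; ring
    rw [h2] at h1
    linarith
  refine Real.sqrt_le_iff.2 ⟨by positivity, h.trans ?_⟩
  have e1 := Real.sq_sqrt (jb_pos p.1).le
  have e2 := Real.sq_sqrt (jb_pos p.2).le
  have e3 := Real.sq_sqrt (jb_pos (k - p.1 - p.2)).le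
  have p1 := Real.sqrt_nonneg (jb p.1)
  have p2 := Real.sqrt_nonneg (jb p.2)
  have p3 := Real.sqrt_nonneg (jb (k - p.1 - p.2))
  nlinarith [mul_nonneg p1 p2, mul_nonneg p1 p3, mul_nonneg p2 p3]

/-- The trilinear convolution of an `H^{1/2} ∩ ℓ¹` sequence is in `H^{1/2}`. -/
theorem HalfBound.conv {U : ℤ → ℝ} {M s : ℝ} (hs : 0 ≤ s) (hU : HalfBound M U)
    (hUs : ∀ S : Finset ℤ, ∑ k ∈ S, U k ≤ s) (P : Finset (ℤ × ℤ)) :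
    HalfBound (3 * M * s ^ 2) fun k => ∑ p ∈ P, U p.1 * U p.2 * U (k - p.1 - p.2) := by
  have hU0 := hU.1
  refine ⟨fun k => Finset.sum_nonneg fun p _ => mul_nonneg (mul_nonneg (hU0 _) (hU0 _)) (hU0 _),
    fun S => ?_⟩
  have t1 := sum_sq_sum_triple_le hs hU hUs P S (fun _ p => p.1) (fun _ p => p.2)
    (fun k p => k - p.1 - p.2)
    (by intro k; rintro ⟨a, b⟩ ⟨a', b'⟩ h; simp only [Prod.mk.injEq] at h ⊢; omega)
    (by rintro ⟨k, a, b⟩ ⟨k', a', b'⟩ h; simp only [Prod.mk.injEq] at h ⊢; omega)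
  have t2 := sum_sq_sum_triple_le hs hU hUs P S (fun _ p => p.2) (fun _ p => p.1)
    (fun k p => k - p.1 - p.2)
    (by intro k; rintro ⟨a, b⟩ ⟨a', b'⟩ h; simp only [Prod.mk.injEq] at h ⊢; omega)
    (by rintro ⟨k, a, b⟩ ⟨k', a', b'⟩ h; simp only [Prod.mk.injEq] at h ⊢; omega)
  have t3 := sum_sq_sum_triple_le hs hU hUs P S (fun k p => k - p.1 - p.2) (fun _ p => p.1)
    (fun _ p => p.2)
    (by intro k; rintro ⟨a, b⟩ ⟨a', b'⟩ h; simp only [Prod.mk.injEq] at h ⊢; omega)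
    (by rintro ⟨k, a, b⟩ ⟨k', a', b'⟩ h; simp only [Prod.mk.injEq] at h ⊢; omega)
  have hk : ∀ k ∈ S, jb k * (∑ p ∈ P, U p.1 * U p.2 * U (k - p.1 - p.2)) ^ 2 ≤
      3 * ((∑ p ∈ P, √(jb p.1) * U p.1 * U p.2 * U (k - p.1 - p.2)) ^ 2 +
      (∑ p ∈ P, √(jb p.2) * U p.2 * U p.1 * U (k - p.1 - p.2)) ^ 2 +
      (∑ p ∈ P, √(jb (k - p.1 - p.2)) * U (k - p.1 - p.2) * U p.1 * U p.2) ^ 2) := by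
    intro k _
    have hle : √(jb k) * ∑ p ∈ P, U p.1 * U p.2 * U (k - p.1 - p.2) ≤
        (∑ p ∈ P, √(jb p.1) * U p.1 * U p.2 * U (k - p.1 - p.2)) +
        (∑ p ∈ P, √(jb p.2) * U p.2 * U p.1 * U (k - p.1 - p.2)) +
        ∑ p ∈ P, √(jb (k - p.1 - p.2)) * U (k - p.1 - p.2) * U p.1 * U p.2 := by
      rw [Finset.mul_sum, ← Finset.sum_add_distrib, ← Finset.sum_add_distrib]
      refine Finset.sum_le_sum fun p _ => ?_
      have := mul_le_mul_of_nonneg_right (jb_add_le k p)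
        (mul_nonneg (mul_nonneg (hU0 p.1) (hU0 p.2)) (hU0 (k - p.1 - p.2)))
      linarith
    have h0 : 0 ≤ √(jb k) * ∑ p ∈ P, U p.1 * U p.2 * U (k - p.1 - p.2) :=
      mul_nonneg (Real.sqrt_nonneg _) (Finset.sum_nonneg fun p _ =>
        mul_nonneg (mul_nonneg (hU0 _) (hU0 _)) (hU0 _))
    have hsq := pow_le_pow_left₀ h0 hle 2
    rw [mul_pow, Real.sq_sqrt (jb_pos k).le] at hsq
    refine hsq.trans ?_
    generalize (∑ p ∈ P, √(jb p.1) * U p.1 * U p.2 * U (k - p.1 - p.2)) = a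
    generalize (∑ p ∈ P, √(jb p.2) * U p.2 * U p.1 * U (k - p.1 - p.2)) = b
    generalize (∑ p ∈ P, √(jb (k - p.1 - p.2)) * U (k - p.1 - p.2) * U p.1 * U p.2) = c
    nlinarith [sq_nonneg (a - b), sq_nonneg (b - c), sq_nonneg (c - a)]
  refine (Finset.sum_le_sum hk).trans ?_
  rw [← Finset.mul_sum, Finset.sum_add_distrib, Finset.sum_add_distrib]
  nlinarith

theorem norm_tsum_sub_sum_le {ι : Type*} {g : ι → ℂ} (hg : Summable g) (A : Finset ι) {c : ℝ}
    (hc : ∀ B : Finset ι, Disjoint B A → ∑ p ∈ B, ‖g p‖ ≤ c) :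
    ‖∑' p, g p - ∑ p ∈ A, g p‖ ≤ c := by
  classical
  have ht : Filter.Tendsto (fun B : Finset ι => ‖∑ p ∈ B, g p - ∑ p ∈ A, g p‖) Filter.atTop
      (nhds ‖∑' p, g p - ∑ p ∈ A, g p‖) :=
    (Filter.Tendsto.sub_const hg.hasSum _).norm
  refine le_of_tendsto ht (Filter.eventually_atTop.2 ⟨A, fun B hB => ?_⟩)
  rw [← Finset.sum_sdiff hB, add_sub_cancel_right]
  exact (norm_sum_le _ _).trans (hc _ Finset.sdiff_disjoint)

theorem norm_mul_mul_sub_le (a b c a' b' c' : ℂ) :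
    ‖a * b * c - a' * b' * c'‖ ≤
      ‖a - a'‖ * ‖b‖ * ‖c‖ + ‖a'‖ * ‖b - b'‖ * ‖c‖ + ‖a'‖ * ‖b'‖ * ‖c - c'‖ := by
  have : a * b * c - a' * b' * c' =
      (a - a') * b * c + a' * (b - b') * c + a' * b' * (c - c') := by ring
  rw [this]
  refine (norm_add₃_le).trans ?_
  simp only [norm_mul, le_refl]

/-- `v` and `w` are dominated by `u`, which is bounded in `H^{1/2}` by `M`, and `v - w` is
bounded by `Z`. -/
structure PairBound (M Z : ℝ) (u : ℤ → ℝ) (v w : ℤ → ℂ) : Prop where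
  one_le : 1 ≤ M
  nonneg : 0 ≤ Z
  half : HalfBound M u
  left : ∀ k, ‖v k‖ ≤ u k
  right : ∀ k, ‖w k‖ ≤ u k
  sub_le : ∀ k, ‖v k - w k‖ ≤ u k
  sup : ∀ k, ‖v k - w k‖ ≤ Z

/-- The cubic product `v_{k₁} v_{k₂} v_{k₃}`. -/
def cubic (v : ℤ → ℂ) (k : ℤ) (p : ℤ × ℤ) : ℂ := v p.1 * v p.2 * v (k - p.1 - p.2)

theorem PairBound.norm_cubic_sub_le {M Z : ℝ} {u : ℤ → ℝ} {v w : ℤ → ℂ}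
    (h : PairBound M Z u v w) (k : ℤ) (p : ℤ × ℤ) :
    ‖cubic v k p - cubic w k p‖ ≤
      Z * (u p.1 * u p.2 + u p.1 * u (k - p.1 - p.2) + u p.2 * u (k - p.1 - p.2)) := by
  refine (norm_mul_mul_sub_le _ _ _ _ _ _).trans ?_
  have hZ := h.nonneg
  have u1 := h.half.1 p.1
  have u2 := h.half.1 p.2
  have u3 := h.half.1 (k - p.1 - p.2)
  have h1 : ‖v p.1 - w p.1‖ * ‖v p.2‖ * ‖v (k - p.1 - p.2)‖ ≤ Z * u p.2 * u (k - p.1 - p.2) := by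
    gcongr
    exacts [h.sup _, h.left _, h.left _]
  have h2 : ‖w p.1‖ * ‖v p.2 - w p.2‖ * ‖v (k - p.1 - p.2)‖ ≤ u p.1 * Z * u (k - p.1 - p.2) := by
    gcongr
    exacts [h.right _, h.sup _, h.left _]
  have h3 : ‖w p.1‖ * ‖w p.2‖ * ‖v (k - p.1 - p.2) - w (k - p.1 - p.2)‖ ≤
      u p.1 * u p.2 * Z := by
    gcongr
    exacts [h.right _, h.right _, h.sup _]
  linarith

theorem norm_cubic_le {u : ℤ → ℝ} {v : ℤ → ℂ} (h : ∀ k, ‖v k‖ ≤ u k) (k : ℤ) (p : ℤ × ℤ) :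
    ‖cubic v k p‖ ≤ u p.1 * u p.2 * u (k - p.1 - p.2) := by
  have h0 : ∀ k, 0 ≤ u k := fun k => (norm_nonneg _).trans (h k)
  unfold cubic
  rw [norm_mul, norm_mul]
  gcongr
  exacts [mul_nonneg (h0 _) (h0 _), h0 _, h _, h _, h _]

theorem norm_exp_phase (t : ℝ) (n : ℤ) : ‖Complex.exp (Complex.I * (t : ℂ) * (n : ℂ))‖ = 1 := by
  have : Complex.I * (t : ℂ) * (n : ℂ) = ((t * n : ℝ) : ℂ) * Complex.I := by
    push_cast; ring
  rw [this, Complex.norm_exp_ofReal_mul_I]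

theorem ntermF_of_ne {v : ℤ → ℂ} {t : ℝ} {k : ℤ} {p : ℤ × ℤ}
    (hp : Phi p.1 p.2 (k - p.1 - p.2) ≠ 0) :
    ntermF v t k p =
      k * Complex.exp (Complex.I * t * ((Phi p.1 p.2 (k - p.1 - p.2) : ℤ) : ℂ)) * cubic v k p := by
  rw [ntermF, if_pos hp, cubic]; ring

theorem ntermF_of_eq {v : ℤ → ℂ} {t : ℝ} {k : ℤ} {p : ℤ × ℤ}
    (hp : Phi p.1 p.2 (k - p.1 - p.2) = 0) : ntermF v t k p = 0 := by
  rw [ntermF, if_neg (not_not.2 hp)]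

theorem norm_ntermF_le (v : ℤ → ℂ) (t : ℝ) (k : ℤ) (p : ℤ × ℤ) :
    ‖ntermF v t k p‖ ≤ |(k : ℝ)| * ‖cubic v k p‖ := by
  by_cases hp : Phi p.1 p.2 (k - p.1 - p.2) = 0
  · rw [ntermF_of_eq hp, norm_zero]; positivity
  · rw [ntermF_of_ne hp, norm_mul, norm_mul, norm_exp_phase, mul_one, Complex.norm_intCast]

theorem norm_ntermF_sub_le (v w : ℤ → ℂ) (t : ℝ) (k : ℤ) (p : ℤ × ℤ) :
    ‖ntermF v t k p - ntermF w t k p‖ ≤ |(k : ℝ)| * ‖cubic v k p - cubic w k p‖ := by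
  by_cases hp : Phi p.1 p.2 (k - p.1 - p.2) = 0
  · rw [ntermF_of_eq hp, ntermF_of_eq hp, sub_zero, norm_zero]; positivity
  · rw [ntermF_of_ne hp, ntermF_of_ne hp, ← mul_sub, norm_mul, norm_mul, norm_exp_phase, mul_one,
      Complex.norm_intCast]

theorem norm_Res_le {v : ℤ → ℂ} {u : ℤ → ℝ} {M : ℝ} (hM : 0 ≤ M) (hu : HalfBound M u)
    (hv : ∀ k, ‖v k‖ ≤ u k) (k : ℤ) : ‖Res v k‖ ≤ |(k : ℝ)| * (M ^ 2 * u k) := by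
  unfold Res
  rw [norm_mul, norm_mul, norm_mul, norm_neg, Complex.norm_I, one_mul, Complex.norm_intCast,
    norm_pow, Complex.norm_real, norm_norm, mul_assoc]
  gcongr
  exacts [(hv k).trans (hu.le hM k), hv k]

theorem PairBound.norm_Res_sub_le {M Z : ℝ} {u : ℤ → ℝ} {v w : ℤ → ℂ}
    (h : PairBound M Z u v w) (k : ℤ) :
    ‖Res v k - Res w k‖ ≤ |(k : ℝ)| * (3 * u k ^ 2 * Z) := by
  have : Res v k - Res w k = -Complex.I * k * (((‖v k‖ : ℝ) : ℂ) * ((‖v k‖ : ℝ) : ℂ) * v k -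
      ((‖w k‖ : ℝ) : ℂ) * ((‖w k‖ : ℝ) : ℂ) * w k) := by
    unfold Res; ring
  rw [this, norm_mul, norm_mul, norm_neg, Complex.norm_I, one_mul, Complex.norm_intCast]
  refine mul_le_mul_of_nonneg_left ?_ (abs_nonneg _)
  refine (norm_mul_mul_sub_le _ _ _ _ _ _).trans ?_
  rw [← Complex.ofReal_sub]
  simp only [Complex.norm_real, norm_norm]
  have hd : ‖‖v k‖ - ‖w k‖‖ ≤ Z := (abs_norm_sub_norm_le _ _).trans (h.sup k)
  have hu := h.half.1 k
  have hl := h.left k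
  have hr := h.right k
  have hs := h.sup k
  have hZ := h.nonneg
  have e1 : ‖‖v k‖ - ‖w k‖‖ * ‖v k‖ * ‖v k‖ ≤ Z * u k * u k := by gcongr
  have e2 : ‖w k‖ * ‖‖v k‖ - ‖w k‖‖ * ‖v k‖ ≤ u k * Z * u k := by gcongr
  have e3 : ‖w k‖ * ‖w k‖ * ‖v k - w k‖ ≤ u k * u k * Z := by gcongr
  linarith

/-- The square box containing all the pairs of frequencies with `⟨k₁⟩, ⟨k₂⟩ ≤ R`. -/
noncomputable def box (R : ℝ) : Finset (ℤ × ℤ) :=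
  Finset.Icc (-⌈R⌉) ⌈R⌉ ×ˢ Finset.Icc (-⌈R⌉) ⌈R⌉

theorem mem_box {R : ℝ} {p : ℤ × ℤ} (h1 : |(p.1 : ℝ)| ≤ R) (h2 : |(p.2 : ℝ)| ≤ R) :
    p ∈ box R := by
  have key : ∀ n : ℤ, |(n : ℝ)| ≤ R → n ∈ Finset.Icc (-⌈R⌉) ⌈R⌉ := by
    intro n hn
    have h : |(n : ℝ)| ≤ (⌈R⌉ : ℝ) := hn.trans (Int.le_ceil R)
    have h' : |n| ≤ ⌈R⌉ := by exact_mod_cast h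
    exact Finset.mem_Icc.2 (abs_le.1 h')
  exact Finset.mem_product.2 ⟨key _ h1, key _ h2⟩

theorem jb_le_of_mul_lt {R : ℝ} {a b c : ℤ} (h : jb a * jb b * jb c < R) :
    jb a ≤ R ∧ jb b ≤ R ∧ jb c ≤ R := by
  have ha := one_le_jb a
  have hb := one_le_jb b
  have hc := one_le_jb c
  have hab : 1 ≤ jb a * jb b := one_le_mul_of_one_le_of_one_le ha hb
  have h1 : jb a * jb b ≤ jb a * jb b * jb c := le_mul_of_one_le_right (by linarith) hc
  have h2 : jb c ≤ jb a * jb b * jb c := le_mul_of_one_le_left (by linarith) hab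
  have h3 : jb a ≤ jb a * jb b := le_mul_of_one_le_right (by linarith) hb
  have h4 : jb b ≤ jb a * jb b := le_mul_of_one_le_left (by linarith) ha
  exact ⟨by linarith, by linarith, by linarith⟩

/-- The constant `C` is admissible in the estimates for symbols and for tails. -/
structure Admissible (C : ℝ) : Prop where
  pos : 0 < C
  pair : ∀ (k : ℤ) (A : Finset (ℤ × ℤ)),
    (∀ p ∈ A, Phi p.1 p.2 (k - p.1 - p.2) ≠ 0) →
    ∀ (f g : ℤ → ℝ) (F G : ℝ), 0 ≤ F → 0 ≤ G → HalfBound F f → HalfBound G g →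
    ∑ p ∈ A, symb k p * (f p.1 * g p.2) ≤ C * (F * G) ∧
    ∑ p ∈ A, symb k p * (f p.1 * g (k - p.1 - p.2)) ≤ C * (F * G) ∧
    ∑ p ∈ A, symb k p * (f p.2 * g (k - p.1 - p.2)) ≤ C * (F * G)
  tail : ∀ (k : ℤ) (B : Finset (ℤ × ℤ))
    (f : ℤ → ℝ) (M R : ℝ), 0 ≤ M → 0 < R → HalfBound M f →
    (∀ p ∈ B, R ≤ jb p.1 * jb p.2 * jb (k - p.1 - p.2)) →
    ∑ p ∈ B, f p.1 * f p.2 * f (k - p.1 - p.2) ≤ C * M ^ 3 * R ^ (-(1 / 12) : ℝ)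

theorem exists_admissible : ∃ C, Admissible C := by
  obtain ⟨C₁, h₁, H₁⟩ := exists_sum_symb_mul_le
  obtain ⟨C₂, h₂, H₂⟩ := exists_sum_triple_tail_le
  refine ⟨C₁ + C₂, by positivity, fun k A hA f g F G hF hG hf hg => ?_,
    fun k B f M R hM hR hf hB => ?_⟩
  · have h : C₁ * (F * G) ≤ (C₁ + C₂) * (F * G) :=
      mul_le_mul_of_nonneg_right (by linarith) (mul_nonneg hF hG)
    obtain ⟨a, b, c⟩ := H₁ k A hA f g F G hF hG hf hg
    exact ⟨a.trans h, b.trans h, c.trans h⟩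
  · refine (H₂ k B f M R hM hR hf hB).trans ?_
    have := Real.rpow_nonneg hR.le (-(1 / 12))
    gcongr
    linarith

section FixedTime

variable {C M Z R : ℝ} {u : ℤ → ℝ} {v w : ℤ → ℂ}

/-- The low-frequency part of the trilinear convolution of `u`. -/
noncomputable def lowConv (R : ℝ) (u : ℤ → ℝ) (k : ℤ) : ℝ :=
  ∑ p ∈ box R, cutoff R u p.1 * cutoff R u p.2 * cutoff R u (k - p.1 - p.2)

theorem sum_triple_le (hC : Admissible C) (hM : 0 ≤ M) (hR : 0 < R) (hu : HalfBound M u)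
    (k : ℤ) (B : Finset (ℤ × ℤ)) :
    ∑ p ∈ B, u p.1 * u p.2 * u (k - p.1 - p.2) ≤
      lowConv R u k + C * M ^ 3 * R ^ (-(1 / 12) : ℝ) := by
  classical
  rw [← Finset.sum_filter_add_sum_filter_not B
    fun p => jb p.1 * jb p.2 * jb (k - p.1 - p.2) < R]
  refine add_le_add ?_ (hC.tail k _ u M R hM hR hu fun p hp =>
    not_lt.1 (Finset.mem_filter.1 hp).2)
  have h0 := cutoff_nonneg (R := R) hu.1
  calc _ = ∑ p ∈ B.filter fun p => jb p.1 * jb p.2 * jb (k - p.1 - p.2) < R,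
        cutoff R u p.1 * cutoff R u p.2 * cutoff R u (k - p.1 - p.2) := by
        refine Finset.sum_congr rfl fun p hp => ?_
        obtain ⟨h1, h2, h3⟩ := jb_le_of_mul_lt (Finset.mem_filter.1 hp).2
        rw [cutoff_of_le h1, cutoff_of_le h2, cutoff_of_le h3]
    _ ≤ _ := by
        refine Finset.sum_le_sum_of_subset_of_nonneg (fun p hp => ?_) fun p _ _ =>
          mul_nonneg (mul_nonneg (h0 _) (h0 _)) (h0 _)
        obtain ⟨h1, h2, -⟩ := jb_le_of_mul_lt (Finset.mem_filter.1 hp).2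
        unfold jb at h1 h2
        exact mem_box (by linarith) (by linarith)

theorem sum_cubic_sub_le (hC : Admissible C) (hR : 1 ≤ R) (h : PairBound M Z u v w)
    (k : ℤ) (B : Finset (ℤ × ℤ)) :
    ∑ p ∈ B, ‖cubic v k p - cubic w k p‖ ≤
      3 * Z * (M ^ 2 * (2 * (1 + Real.log R))) + 2 * C * M ^ 3 * R ^ (-(1 / 12) : ℝ) := by
  classical
  have hM : 0 ≤ M := zero_le_one.trans h.one_le
  have hl : 0 ≤ 2 * (1 + Real.log R) := by linarith [Real.log_nonneg hR]
  rw [← Finset.sum_filter_add_sum_filter_not B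
    fun p => jb p.1 * jb p.2 * jb (k - p.1 - p.2) < R]
  refine add_le_add ?_ ?_
  · have h0 := cutoff_nonneg (R := R) h.half.1
    have hs := h.half.sum_cutoff_le hM hR
    set A := B.filter fun p => jb p.1 * jb p.2 * jb (k - p.1 - p.2) < R with hA
    have key : ∀ x y : ℤ × ℤ → ℤ, Function.Injective (fun p => (x p, y p)) →
        ∑ p ∈ A, cutoff R u (x p) * cutoff R u (y p) ≤ M ^ 2 * (2 * (1 + Real.log R)) := by
      intro x y hxy
      refine (sum_mul_le_of_injOn h0 h0 hs hs A hxy.injOn).trans (le_of_eq ?_)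
      rw [mul_mul_mul_comm, Real.mul_self_sqrt hl]
      ring
    have i1 := key (fun p => p.1) (fun p => p.2) (fun p q h => h)
    have i2 := key (fun p => p.2) (fun p => k - p.1 - p.2) (by
      rintro ⟨a, b⟩ ⟨a', b'⟩ h; simp only [Prod.mk.injEq] at h ⊢; omega)
    have i3 := key (fun p => p.1) (fun p => k - p.1 - p.2) (by
      rintro ⟨a, b⟩ ⟨a', b'⟩ h; simp only [Prod.mk.injEq] at h ⊢; omega)
    have hle : ∀ p ∈ A, ‖cubic v k p - cubic w k p‖ ≤ Z * (cutoff R u p.1 * cutoff R u p.2 +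
        cutoff R u p.1 * cutoff R u (k - p.1 - p.2) +
        cutoff R u p.2 * cutoff R u (k - p.1 - p.2)) := by
      intro p hp
      obtain ⟨h1, h2, h3⟩ := jb_le_of_mul_lt (Finset.mem_filter.1 hp).2
      rw [cutoff_of_le h1, cutoff_of_le h2, cutoff_of_le h3]
      exact h.norm_cubic_sub_le k p
    refine (Finset.sum_le_sum hle).trans ?_
    rw [← Finset.mul_sum, Finset.sum_add_distrib, Finset.sum_add_distrib]
    refine (mul_le_mul_of_nonneg_left (add_le_add (add_le_add i1 i3) i2) h.nonneg).trans
      (le_of_eq (by ring))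
  · have := hC.tail k (B.filter fun p => ¬ jb p.1 * jb p.2 * jb (k - p.1 - p.2) < R) u M R hM
      (by linarith) h.half fun p hp => not_lt.1 (Finset.mem_filter.1 hp).2
    have hle : ∀ p ∈ B.filter fun p => ¬ jb p.1 * jb p.2 * jb (k - p.1 - p.2) < R,
        ‖cubic v k p - cubic w k p‖ ≤ 2 * (u p.1 * u p.2 * u (k - p.1 - p.2)) := by
      intro p _
      linarith [norm_sub_le (cubic v k p) (cubic w k p), norm_cubic_le h.left k p,
        norm_cubic_le h.right k p]
    refine (Finset.sum_le_sum hle).trans ?_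
    rw [← Finset.mul_sum]
    linarith

theorem norm_I_div_three_mul_le (z : ℂ) : ‖Complex.I / 3 * z‖ ≤ ‖z‖ := by
  rw [norm_mul, norm_div, Complex.norm_I]
  norm_num
  linarith [norm_nonneg z]

theorem norm_rhs_le (hC : Admissible C) (hM : 0 ≤ M) (hR : 0 < R) (hu : HalfBound M u)
    (hw : ∀ k, ‖w k‖ ≤ u k) {t : ℝ} {k : ℤ} (hs : Summable fun p => ntermF w t k p) :
    ‖Nonres w t k + Res w k‖ ≤
      |(k : ℝ)| * (lowConv R u k + M ^ 2 * u k + C * M ^ 3 * R ^ (-(1 / 12) : ℝ)) := by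
  have h1 : ‖Nonres w t k‖ ≤
      |(k : ℝ)| * (lowConv R u k + C * M ^ 3 * R ^ (-(1 / 12) : ℝ)) := by
    unfold Nonres
    refine (norm_I_div_three_mul_le _).trans ?_
    have := norm_tsum_sub_sum_le hs ∅
      (c := |(k : ℝ)| * (lowConv R u k + C * M ^ 3 * R ^ (-(1 / 12) : ℝ))) (fun B _ => by
        refine (Finset.sum_le_sum fun p _ => (norm_ntermF_le w t k p).trans
          (mul_le_mul_of_nonneg_left (norm_cubic_le hw k p) (abs_nonneg _))).trans ?_
        rw [← Finset.mul_sum]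
        exact mul_le_mul_of_nonneg_left (sum_triple_le hC hM hR hu k B) (abs_nonneg _))
    simpa using this
  refine (norm_add_le _ _).trans ((add_le_add h1 (norm_Res_le hM hu hw k)).trans
    (le_of_eq (by ring)))

theorem norm_rhs_sub_le (hC : Admissible C) (hR : 1 ≤ R) (h : PairBound M Z u v w)
    {t : ℝ} {k : ℤ} (hv : Summable fun p => ntermF v t k p)
    (hw : Summable fun p => ntermF w t k p) :
    ‖(Nonres v t k + Res v k) - (Nonres w t k + Res w k)‖ ≤
      |(k : ℝ)| * (3 * Z * (M ^ 2 * (2 * (1 + Real.log R))) +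
        2 * C * M ^ 3 * R ^ (-(1 / 12) : ℝ) + 3 * M ^ 2 * Z) := by
  have hM : 0 ≤ M := zero_le_one.trans h.one_le
  have h1 : ‖Nonres v t k - Nonres w t k‖ ≤
      |(k : ℝ)| * (3 * Z * (M ^ 2 * (2 * (1 + Real.log R))) +
        2 * C * M ^ 3 * R ^ (-(1 / 12) : ℝ)) := by
    unfold Nonres
    rw [← mul_sub, ← hv.tsum_sub hw]
    refine (norm_I_div_three_mul_le _).trans ?_
    have := norm_tsum_sub_sum_le (hv.sub hw) ∅
      (c := |(k : ℝ)| * (3 * Z * (M ^ 2 * (2 * (1 + Real.log R))) +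
        2 * C * M ^ 3 * R ^ (-(1 / 12) : ℝ))) (fun B _ => by
        refine (Finset.sum_le_sum fun p _ => norm_ntermF_sub_le v w t k p).trans ?_
        rw [← Finset.mul_sum]
        exact mul_le_mul_of_nonneg_left (sum_cubic_sub_le hC hR h k B) (abs_nonneg _))
    simpa using this
  have h2 : ‖Res v k - Res w k‖ ≤ |(k : ℝ)| * (3 * M ^ 2 * Z) := by
    refine (h.norm_Res_sub_le k).trans ?_
    have := h.half.1 k
    have := h.half.le hM k
    have := h.nonneg
    gcongr
  rw [add_sub_add_comm]
  exact (norm_add_le _ _).trans ((add_le_add h1 h2).trans (le_of_eq (by ring)))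

end FixedTime

/-- The formal derivative of the cubic product when `v` has derivative `v'`. -/
def cubicDeriv (v v' : ℤ → ℂ) (k : ℤ) (p : ℤ × ℤ) : ℂ :=
  (v' p.1 * v p.2 + v p.1 * v' p.2) * v (k - p.1 - p.2) + v p.1 * v p.2 * v' (k - p.1 - p.2)

theorem norm_mul_mul_sub_le_of_le {κ D G H Z x y : ℝ} {a b c a' b' c' : ℂ} (hκ : 0 ≤ κ)
    (hD : 0 ≤ D) (hG : 0 ≤ G) (hH : 0 ≤ H) (hZ : 0 ≤ Z)
    (ha : ‖a - a'‖ ≤ κ * D) (ha' : ‖a'‖ ≤ κ * (G + H))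
    (hb : ‖b‖ ≤ x) (hb' : ‖b'‖ ≤ x) (hbx : ‖b - b'‖ ≤ x) (hbZ : ‖b - b'‖ ≤ Z)
    (hc : ‖c‖ ≤ y) (hcy : ‖c - c'‖ ≤ y) (hcZ : ‖c - c'‖ ≤ Z) :
    ‖a * b * c - a' * b' * c'‖ ≤ κ * ((D + 2 * H) * (x * y) + Z * (G * y + G * x)) := by
  have hx0 : 0 ≤ x := (norm_nonneg _).trans hb
  have hy0 : 0 ≤ y := (norm_nonneg _).trans hc
  refine (norm_mul_mul_sub_le _ _ _ _ _ _).trans ?_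
  have h1 : ‖a - a'‖ * ‖b‖ * ‖c‖ ≤ κ * D * x * y := by gcongr
  have h2 : ‖a'‖ * ‖b - b'‖ * ‖c‖ ≤ κ * (G * Z + H * x) * y := by
    refine mul_le_mul ?_ hc (norm_nonneg _) (by positivity)
    calc ‖a'‖ * ‖b - b'‖ ≤ κ * (G + H) * ‖b - b'‖ := by gcongr
      _ = κ * (G * ‖b - b'‖ + H * ‖b - b'‖) := by ring
      _ ≤ κ * (G * Z + H * x) := by gcongr
  have h3 : ‖a'‖ * ‖b'‖ * ‖c - c'‖ ≤ κ * (G * Z + H * y) * x := by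
    rw [mul_right_comm]
    refine mul_le_mul ?_ hb' (norm_nonneg _) (by positivity)
    calc ‖a'‖ * ‖c - c'‖ ≤ κ * (G + H) * ‖c - c'‖ := by gcongr
      _ = κ * (G * ‖c - c'‖ + H * ‖c - c'‖) := by ring
      _ ≤ κ * (G * Z + H * y) := by gcongr
  calc _ ≤ _ := add_le_add (add_le_add h1 h2) h3
    _ = _ := by ring

section FixedTime

variable {C M Z R : ℝ} {u : ℤ → ℝ} {v w : ℤ → ℂ}

theorem PairBound.norm_cubicDeriv_sub_le (h : PairBound M Z u v w) {v' w' : ℤ → ℂ} {D H : ℝ}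
    {G : ℤ → ℝ} (hD : 0 ≤ D) (hG : ∀ j, 0 ≤ G j) (hH : 0 ≤ H)
    (hsub : ∀ j, ‖v' j - w' j‖ ≤ |(j : ℝ)| * D) (hw' : ∀ j, ‖w' j‖ ≤ |(j : ℝ)| * (G j + H))
    (k : ℤ) (p : ℤ × ℤ) :
    ‖cubicDeriv v v' k p - cubicDeriv w w' k p‖ ≤
      (|(p.1 : ℝ)| + |(p.2 : ℝ)| + |((k - p.1 - p.2 : ℤ) : ℝ)|) *
      ((D + 2 * H) * (u p.1 * u p.2 + u p.1 * u (k - p.1 - p.2) + u p.2 * u (k - p.1 - p.2)) +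
        Z * (G p.1 * u p.2 + G p.1 * u (k - p.1 - p.2) + G p.2 * u (k - p.1 - p.2) +
          (u p.1 * G p.2 + u p.1 * G (k - p.1 - p.2) + u p.2 * G (k - p.1 - p.2)))) := by
  obtain ⟨r, hr⟩ : ∃ r, r = k - p.1 - p.2 := ⟨_, rfl⟩
  obtain ⟨m, hm⟩ : ∃ m, m = p.1 := ⟨_, rfl⟩
  obtain ⟨n, hn⟩ : ∃ n, n = p.2 := ⟨_, rfl⟩
  unfold cubicDeriv
  rw [← hr, ← hm, ← hn]
  have key : ∀ i j l : ℤ, ‖v' i * v j * v l - w' i * w j * w l‖ ≤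
      |(i : ℝ)| * ((D + 2 * H) * (u j * u l) + Z * (G i * u l + G i * u j)) := fun i j l =>
    norm_mul_mul_sub_le_of_le (abs_nonneg _) hD (hG i) hH h.nonneg (hsub i) (hw' i)
      (h.left j) (h.right j) (h.sub_le j) (h.sup j) (h.left l) (h.sub_le l) (h.sup l)
  have e : (v' m * v n + v m * v' n) * v r + v m * v n * v' r -
      ((w' m * w n + w m * w' n) * w r + w m * w n * w' r) =
      (v' m * v n * v r - w' m * w n * w r) + (v' n * v m * v r - w' n * w m * w r) +
        (v' r * v m * v n - w' r * w m * w n) := by ring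
  rw [e]
  refine norm_add₃_le.trans ((add_le_add (add_le_add (key m n r) (key n m r)) (key r m n)).trans ?_)
  have hZ := h.nonneg
  have um := h.half.1 m
  have un := h.half.1 n
  have ur := h.half.1 r
  have gm := hG m
  have gn := hG n
  have gr := hG r
  have hDH : 0 ≤ D + 2 * H := by positivity
  have step : ∀ {κ a a' b b' : ℝ}, 0 ≤ κ → a ≤ a' → b ≤ b' →
      κ * ((D + 2 * H) * a + Z * b) ≤ κ * ((D + 2 * H) * a' + Z * b') := fun hκ ha hb =>
    mul_le_mul_of_nonneg_left (add_le_add (mul_le_mul_of_nonneg_left ha hDH)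
      (mul_le_mul_of_nonneg_left hb hZ)) hκ
  rw [add_mul (|(m : ℝ)| + |(n : ℝ)|), add_mul |(m : ℝ)|]
  refine add_le_add (add_le_add (step (abs_nonneg _) ?_ ?_) (step (abs_nonneg _) ?_ ?_))
    (step (abs_nonneg _) ?_ ?_)
  all_goals
    linarith [mul_nonneg um un, mul_nonneg um ur, mul_nonneg un ur, mul_nonneg gm un,
      mul_nonneg gm ur, mul_nonneg gn ur, mul_nonneg um gn, mul_nonneg um gr, mul_nonneg un gr]

theorem halfBound_lowConv_add (hM : 1 ≤ M) (hR : 1 ≤ R) (hu : HalfBound M u) :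
    HalfBound (7 * M ^ 3 * (2 * (1 + Real.log R))) fun k => lowConv R u k + M ^ 2 * u k := by
  have hM0 : 0 ≤ M := zero_le_one.trans hM
  have hl := Real.log_nonneg hR
  have h1 := (hu.cutoff R).conv (s := M * √(2 * (1 + Real.log R))) (by positivity)
    (hu.sum_cutoff_le hM0 hR) (box R)
  have h2 := h1.add (by positivity) (by positivity) (hu.const_mul (sq_nonneg M))
  refine ⟨h2.1, fun S => (h2.2 S).trans (pow_le_pow_left₀ (by positivity) ?_ 2)⟩
  rw [mul_pow, Real.sq_sqrt (by positivity)]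
  have : 0 ≤ M ^ 3 * Real.log R := by positivity
  nlinarith [pow_nonneg hM0 3]

/-- Estimate of the quintic terms produced by a differentiation by parts. -/
theorem sum_cubicDeriv_le (hC : Admissible C) (hR : 1 ≤ R) (h : PairBound M Z u v w) {t : ℝ}
    (hv : ∀ j, Summable fun p => ntermF v t j p) (hw : ∀ j, Summable fun p => ntermF w t j p)
    (k : ℤ) (A : Finset (ℤ × ℤ)) (hA : ∀ p ∈ A, Phi p.1 p.2 (k - p.1 - p.2) ≠ 0) :
    ∑ p ∈ A, |(k : ℝ)| / |((Phi p.1 p.2 (k - p.1 - p.2) : ℤ) : ℝ)| *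
      ‖cubicDeriv v (fun j => Nonres v t j + Res v j) k p -
        cubicDeriv w (fun j => Nonres w t j + Res w j) k p‖ ≤
      57 * C * M ^ 4 * (2 * (1 + Real.log R)) * Z + 12 * C ^ 2 * M ^ 5 * R ^ (-(1 / 12) : ℝ) := by
  have hM : 0 ≤ M := zero_le_one.trans h.one_le
  have hZ := h.nonneg
  have hC0 := hC.pos
  obtain ⟨l, hl⟩ : ∃ l, l = 2 * (1 + Real.log R) := ⟨_, rfl⟩
  obtain ⟨ρ, hρ⟩ : ∃ ρ, ρ = R ^ (-(1 / 12) : ℝ) := ⟨_, rfl⟩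
  obtain ⟨D, hD⟩ : ∃ D, D = 3 * Z * (M ^ 2 * l) + 2 * C * M ^ 3 * ρ + 3 * M ^ 2 * Z := ⟨_, rfl⟩
  obtain ⟨G, hG⟩ : ∃ G : ℤ → ℝ, G = fun j => lowConv R u j + M ^ 2 * u j := ⟨_, rfl⟩
  have hl2 : 2 ≤ l := by rw [hl]; linarith [Real.log_nonneg hR]
  have hρ0 : 0 ≤ ρ := by rw [hρ]; positivity
  have hD0 : 0 ≤ D := by rw [hD]; positivity
  have hGb : HalfBound (7 * M ^ 3 * l) G := by
    rw [hG, hl]; exact halfBound_lowConv_add h.one_le hR h.half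
  have hΓ : 0 ≤ 7 * M ^ 3 * l := by positivity
  have hH0 : 0 ≤ C * M ^ 3 * ρ := by positivity
  rw [← hl, ← hρ]
  have hle := h.norm_cubicDeriv_sub_le (v' := fun j => Nonres v t j + Res v j)
    (w' := fun j => Nonres w t j + Res w j) hD0 hGb.1 hH0
    (fun j => by rw [hD, hl, hρ]; exact norm_rhs_sub_le hC hR h (hv j) (hw j))
    (fun j => by
      rw [hG, hρ]; exact norm_rhs_le hC hM (by linarith) h.half h.right (hw j)) k
  obtain ⟨a1, a2, a3⟩ := hC.pair k A hA u u M M hM hM h.half h.half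
  obtain ⟨b1, b2, b3⟩ := hC.pair k A hA G u _ M hΓ hM hGb h.half
  obtain ⟨c1, c2, c3⟩ := hC.pair k A hA u G M _ hM hΓ h.half hGb
  calc _ ≤ ∑ p ∈ A, ((D + 2 * (C * M ^ 3 * ρ)) * (symb k p * (u p.1 * u p.2) +
        symb k p * (u p.1 * u (k - p.1 - p.2)) + symb k p * (u p.2 * u (k - p.1 - p.2))) +
        Z * (symb k p * (G p.1 * u p.2) + symb k p * (G p.1 * u (k - p.1 - p.2)) +
          symb k p * (G p.2 * u (k - p.1 - p.2)) +
          (symb k p * (u p.1 * G p.2) + symb k p * (u p.1 * G (k - p.1 - p.2)) +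
          symb k p * (u p.2 * G (k - p.1 - p.2))))) := by
        refine Finset.sum_le_sum fun p _ =>
          (mul_le_mul_of_nonneg_left (hle p) (by positivity)).trans (le_of_eq ?_)
        unfold symb
        ring
    _ ≤ (D + 2 * (C * M ^ 3 * ρ)) * (C * (M * M) + C * (M * M) + C * (M * M)) +
        Z * (C * (7 * M ^ 3 * l * M) + C * (7 * M ^ 3 * l * M) + C * (7 * M ^ 3 * l * M) +
          (C * (M * (7 * M ^ 3 * l)) + C * (M * (7 * M ^ 3 * l)) + C * (M * (7 * M ^ 3 * l)))) := by
        simp only [Finset.sum_add_distrib, ← Finset.mul_sum]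
        gcongr
    _ ≤ _ := by
        rw [hD]
        have : 0 ≤ C * M ^ 4 * Z * (l - 2) :=
          mul_nonneg (by positivity) (by linarith)
        have : 0 ≤ C * M ^ 4 * Z * l := by positivity
        linarith

/-- The admissible frequencies, up to `K`, at which differentiation by parts is performed. -/
noncomputable def highSet (K L : ℝ) (k : ℤ) : Finset (ℤ × ℤ) :=
  (box K).filter fun p => Phi p.1 p.2 (k - p.1 - p.2) ≠ 0 ∧
    L ≤ |(p.1 : ℝ)| + |(p.2 : ℝ)| + |((k - p.1 - p.2 : ℤ) : ℝ)|

theorem sum_boundary_le (hC : Admissible C) (h : PairBound M Z u v w) {K L : ℝ} (hL : 0 < L)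
    (k : ℤ) :
    ∑ p ∈ highSet K L k, |(k : ℝ)| / |((Phi p.1 p.2 (k - p.1 - p.2) : ℤ) : ℝ)| *
      ‖cubic v k p - cubic w k p‖ ≤ 3 * C * M ^ 2 / L * Z := by
  have hM : 0 ≤ M := zero_le_one.trans h.one_le
  have hZ := h.nonneg
  have hA : ∀ p ∈ highSet K L k, Phi p.1 p.2 (k - p.1 - p.2) ≠ 0 := fun p hp =>
    (Finset.mem_filter.1 hp).2.1
  obtain ⟨a1, a2, a3⟩ := hC.pair k (highSet K L k) hA u u M M hM hM h.half h.half
  calc _ ≤ ∑ p ∈ highSet K L k, Z / L * (symb k p * (u p.1 * u p.2) +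
        symb k p * (u p.1 * u (k - p.1 - p.2)) + symb k p * (u p.2 * u (k - p.1 - p.2))) := by
        refine Finset.sum_le_sum fun p hp => ?_
        have hs := (Finset.mem_filter.1 hp).2.2
        have hq : |(k : ℝ)| / |((Phi p.1 p.2 (k - p.1 - p.2) : ℤ) : ℝ)| ≤ symb k p / L := by
          rw [le_div_iff₀ hL, symb, div_mul_eq_mul_div]
          gcongr
        refine (mul_le_mul hq (h.norm_cubic_sub_le k p) (norm_nonneg _)
          (div_nonneg (symb_nonneg k p) hL.le)).trans (le_of_eq (by ring))
    _ ≤ Z / L * (C * (M * M) + C * (M * M) + C * (M * M)) := by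
        rw [← Finset.mul_sum, Finset.sum_add_distrib, Finset.sum_add_distrib]
        gcongr
    _ = _ := by ring

theorem norm_tsum_sub_sum_highSet_le (hC : Admissible C) (h : PairBound M Z u v w) {K L t : ℝ}
    (hK : 0 < K) (hL : 0 < L) {k : ℤ} (hv : Summable fun p => ntermF v t k p)
    (hw : Summable fun p => ntermF w t k p) :
    ‖∑' p, (ntermF v t k p - ntermF w t k p) -
      ∑ p ∈ highSet K L k, (ntermF v t k p - ntermF w t k p)‖ ≤
      (box L).card * (3 * L * M ^ 2 * Z) + |(k : ℝ)| * (2 * C * M ^ 3 * K ^ (-(1 / 12) : ℝ)) := by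
  classical
  have hM : 0 ≤ M := zero_le_one.trans h.one_le
  have hZ := h.nonneg
  have hu := h.half.1
  refine norm_tsum_sub_sum_le (hv.sub hw) _ fun B hB => ?_
  have hle : ∀ p ∈ B, ‖ntermF v t k p - ntermF w t k p‖ ≤
      (if p ∈ box L then 3 * L * M ^ 2 * Z else 0) +
      (if K ≤ jb p.1 * jb p.2 * jb (k - p.1 - p.2) then
        |(k : ℝ)| * (2 * (u p.1 * u p.2 * u (k - p.1 - p.2))) else 0) := by
    intro p hp
    have n1 : 0 ≤ if p ∈ box L then 3 * L * M ^ 2 * Z else 0 := by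
      split_ifs <;> positivity
    have n2 : 0 ≤ if K ≤ jb p.1 * jb p.2 * jb (k - p.1 - p.2) then
        |(k : ℝ)| * (2 * (u p.1 * u p.2 * u (k - p.1 - p.2))) else 0 := by
      have := mul_nonneg (mul_nonneg (hu p.1) (hu p.2)) (hu (k - p.1 - p.2))
      split_ifs <;> positivity
    by_cases h0 : Phi p.1 p.2 (k - p.1 - p.2) = 0
    · rw [ntermF_of_eq h0, ntermF_of_eq h0, sub_zero, norm_zero]
      exact add_nonneg n1 n2
    by_cases hs : L ≤ |(p.1 : ℝ)| + |(p.2 : ℝ)| + |((k - p.1 - p.2 : ℤ) : ℝ)|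
    · have hK' : K ≤ jb p.1 * jb p.2 * jb (k - p.1 - p.2) := by
        by_contra! hlt
        obtain ⟨h1, h2, -⟩ := jb_le_of_mul_lt hlt
        unfold jb at h1 h2
        exact Finset.disjoint_left.1 hB hp (Finset.mem_filter.2
          ⟨mem_box (by linarith) (by linarith), h0, hs⟩)
      rw [if_pos hK']
      refine le_trans ((norm_ntermF_sub_le v w t k p).trans ?_) (le_add_of_nonneg_left n1)
      refine mul_le_mul_of_nonneg_left ?_ (abs_nonneg _)
      linarith [norm_sub_le (cubic v k p) (cubic w k p), norm_cubic_le h.left k p,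
        norm_cubic_le h.right k p]
    · push Not at hs
      have e1 := abs_nonneg (p.1 : ℝ)
      have e2 := abs_nonneg (p.2 : ℝ)
      have e3 := abs_nonneg ((k - p.1 - p.2 : ℤ) : ℝ)
      rw [if_pos (mem_box (by linarith) (by linarith))]
      refine le_trans ((norm_ntermF_sub_le v w t k p).trans ?_) (le_add_of_nonneg_right n2)
      have hk : |(k : ℝ)| ≤ L := by
        have := abs_add_three (p.1 : ℝ) (p.2 : ℝ) ((k - p.1 - p.2 : ℤ) : ℝ)
        have h2 : (p.1 : ℝ) + (p.2 : ℝ) + ((k - p.1 - p.2 : ℤ) : ℝ) = k := by push_cast; ring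
        rw [h2] at this
        linarith
      have m1 := h.half.le hM p.1
      have m2 := h.half.le hM p.2
      have m3 := h.half.le hM (k - p.1 - p.2)
      have u1 := hu p.1
      have u2 := hu p.2
      have u3 := hu (k - p.1 - p.2)
      calc |(k : ℝ)| * ‖cubic v k p - cubic w k p‖
          ≤ L * (Z * (u p.1 * u p.2 + u p.1 * u (k - p.1 - p.2) +
            u p.2 * u (k - p.1 - p.2))) := by
            refine mul_le_mul hk (h.norm_cubic_sub_le k p) (norm_nonneg _) hL.le
        _ ≤ L * (Z * (M * M + M * M + M * M)) := by gcongr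
        _ = _ := by ring
  refine (Finset.sum_le_sum hle).trans ?_
  rw [Finset.sum_add_distrib]
  refine add_le_add ?_ ?_
  · rw [← Finset.sum_filter, Finset.sum_const, nsmul_eq_mul]
    gcongr
    exact fun p hp => (Finset.mem_filter.1 hp).2
  · rw [← Finset.sum_filter, ← Finset.mul_sum, ← Finset.mul_sum]
    refine mul_le_mul_of_nonneg_left ?_ (abs_nonneg _)
    have := hC.tail k (B.filter fun p => K ≤ jb p.1 * jb p.2 * jb (k - p.1 - p.2)) u M K hM hK
      h.half fun p hp => (Finset.mem_filter.1 hp).2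
    linarith

end FixedTime

/-- The coefficient arising from a differentiation by parts in time. -/
noncomputable def phase (t : ℝ) (k n : ℤ) : ℂ :=
  k * Complex.exp (Complex.I * t * (n : ℂ)) / (Complex.I * n)

theorem norm_phase (t : ℝ) (k n : ℤ) : ‖phase t k n‖ = |(k : ℝ)| / |(n : ℝ)| := by
  rw [phase, norm_div, norm_mul, norm_mul, norm_exp_phase, mul_one, Complex.norm_I, one_mul,
    Complex.norm_intCast, Complex.norm_intCast]

theorem hasDerivWithinAt_phase {S : Set ℝ} (t : ℝ) (k : ℤ) {n : ℤ} (hn : n ≠ 0) :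
    HasDerivWithinAt (fun τ => phase τ k n) (k * Complex.exp (Complex.I * t * (n : ℂ))) S t := by
  have hn' : (Complex.I * (n : ℂ)) ≠ 0 := mul_ne_zero Complex.I_ne_zero (Int.cast_ne_zero.2 hn)
  have h1 : HasDerivAt (fun τ : ℝ => Complex.I * (τ : ℂ) * (n : ℂ)) (Complex.I * n) t := by
    simpa using ((Complex.ofRealCLM.hasDerivAt (x := t)).const_mul Complex.I).mul_const (n : ℂ)
  have h2 := (h1.cexp.const_mul (k : ℂ)).div_const (Complex.I * n)
  refine (h2.congr_deriv ?_).hasDerivWithinAt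
  field_simp

theorem hasDerivWithinAt_cubic {S : Set ℝ} {v : ℝ → ℤ → ℂ} {v' : ℤ → ℂ} {t : ℝ}
    (h : ∀ j, HasDerivWithinAt (fun τ => v τ j) (v' j) S t) (k : ℤ) (p : ℤ × ℤ) :
    HasDerivWithinAt (fun τ => cubic (v τ) k p) (cubicDeriv (v t) v' k p) S t :=
  ((h _).mul (h _)).mul (h _)

/-- The difference of two solutions, corrected by the boundary terms of the differentiation
by parts. -/
noncomputable def normalForm (K L : ℝ) (v w : ℝ → ℤ → ℂ) (k : ℤ) (t : ℝ) : ℂ :=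
  v t k - w t k - Complex.I / 3 * ∑ p ∈ highSet K L k,
    phase t k (Phi p.1 p.2 (k - p.1 - p.2)) * (cubic (v t) k p - cubic (w t) k p)

section NormalForm

variable {s T C M Z R K : ℝ} {v w : ℝ → ℤ → ℂ}

theorem norm_sub_normalForm_le (hC : Admissible C) {u : ℤ → ℝ} {t : ℝ}
    (h : PairBound M Z u (v t) (w t)) (k : ℤ) :
    ‖v t k - w t k - normalForm K (12 * C * M ^ 2) v w k t‖ ≤ Z / 4 := by
  have hM : 0 < M := zero_lt_one.trans_le h.one_le
  have hC0 := hC.pos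
  rw [normalForm, sub_sub_cancel]
  refine (norm_I_div_three_mul_le _).trans ((norm_sum_le _ _).trans ?_)
  simp only [norm_mul, norm_phase]
  refine (sum_boundary_le hC h (by positivity) k).trans (le_of_eq ?_)
  field_simp
  ring

/-- The constant in front of the difference in the estimate for the normal form equation. -/
noncomputable def growthConst (C M : ℝ) : ℝ :=
  3 * M ^ 2 + (box (12 * C * M ^ 2)).card * (36 * C * M ^ 4) + 57 * C * M ^ 4

theorem growthConst_pos (hC : 0 < C) (hM : 1 ≤ M) : 0 < growthConst C M := by
  have : 0 < M := zero_lt_one.trans_le hM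
  unfold growthConst
  positivity

theorem exists_hasDerivWithinAt_normalForm (hC : Admissible C) (hv : IsSolution s T v)
    (hw : IsSolution s T w) (hK : 0 < K) (k : ℤ) {t : ℝ} (ht : t ∈ Set.Icc 0 T) :
    ∃ y', HasDerivWithinAt (normalForm K (12 * C * M ^ 2) v w k) y' (Set.Icc 0 T) t ∧
      ∀ Z R u, 1 ≤ R → PairBound M Z u (v t) (w t) →
        ‖y'‖ ≤ growthConst C M * (2 * (1 + Real.log R)) * Z +
          12 * C ^ 2 * M ^ 5 * R ^ (-(1 / 12) : ℝ) +
          |(k : ℝ)| * (2 * C * M ^ 3 * K ^ (-(1 / 12) : ℝ)) := by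
  have hvs := fun j => (hv.abs_summable t ht j).of_norm
  have hws := fun j => (hw.abs_summable t ht j).of_norm
  obtain ⟨L, hL⟩ : ∃ L, L = 12 * C * M ^ 2 := ⟨_, rfl⟩
  rw [← hL]
  have hA : ∀ p ∈ highSet K L k, Phi p.1 p.2 (k - p.1 - p.2) ≠ 0 := fun p hp =>
    (Finset.mem_filter.1 hp).2.1
  refine ⟨_, ((hv.eqn t ht k).fun_sub (hw.eqn t ht k)).fun_sub
    ((HasDerivWithinAt.fun_sum fun p hp => (hasDerivWithinAt_phase t k (hA p hp)).fun_mul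
      ((hasDerivWithinAt_cubic (hv.eqn t ht) k p).fun_sub
        (hasDerivWithinAt_cubic (hw.eqn t ht) k p))).const_mul _), ?_⟩
  intro Z R u hR h
  have hM : 0 < M := zero_lt_one.trans_le h.one_le
  have hC0 := hC.pos
  have hZ := h.nonneg
  have hl := Real.log_nonneg hR
  have e1 : ∑ p ∈ highSet K L k,
      (k * Complex.exp (Complex.I * t * ((Phi p.1 p.2 (k - p.1 - p.2) : ℤ) : ℂ))) *
        (cubic (v t) k p - cubic (w t) k p) =
      ∑ p ∈ highSet K L k, (ntermF (v t) t k p - ntermF (w t) t k p) :=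
    Finset.sum_congr rfl fun p hp => by
      rw [ntermF_of_ne (hA p hp), ntermF_of_ne (hA p hp), mul_sub]
  have e2 : Nonres (v t) t k - Nonres (w t) t k =
      Complex.I / 3 * ∑' p, (ntermF (v t) t k p - ntermF (w t) t k p) := by
    rw [Nonres, Nonres, ← mul_sub, (hvs k).tsum_sub (hws k)]
  have b1 := norm_tsum_sub_sum_highSet_le hC h hK (L := L) (by rw [hL]; positivity) (hvs k) (hws k)
  have b2 := sum_cubicDeriv_le hC hR h hvs hws k _ hA
  have b3 : ‖Res (v t) k - Res (w t) k‖ ≤ 3 * M ^ 2 * Z := by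
    refine (h.norm_Res_sub_le k).trans ?_
    have := h.half.jb_mul_sq_le k
    have : |(k : ℝ)| * u k ^ 2 ≤ M ^ 2 := by
      refine le_trans (mul_le_mul_of_nonneg_right ?_ (sq_nonneg _)) this
      unfold jb; linarith
    nlinarith
  have b2' : ‖∑ p ∈ highSet K L k, phase t k (Phi p.1 p.2 (k - p.1 - p.2)) *
      (cubicDeriv (v t) (fun j => Nonres (v t) t j + Res (v t) j) k p -
        cubicDeriv (w t) (fun j => Nonres (w t) t j + Res (w t) j) k p)‖ ≤
      57 * C * M ^ 4 * (2 * (1 + Real.log R)) * Z + 12 * C ^ 2 * M ^ 5 * R ^ (-(1 / 12) : ℝ) := by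
    refine (norm_sum_le _ _).trans ?_
    simp only [norm_mul, norm_phase]
    exact b2
  have e3 : ∀ a b c d e f : ℂ, a - b = Complex.I / 3 * e →
      a + c - (b + d) - Complex.I / 3 * f = (c - d) + Complex.I / 3 * (e - f) := by
    intro a b c d e f h
    linear_combination h
  rw [Finset.sum_add_distrib, e1, e3 _ _ _ _ _ _ e2]
  rw [← sub_sub]
  refine (norm_add_le _ _).trans ((add_le_add b3 ((norm_I_div_three_mul_le _).trans
    ((norm_sub_le _ _).trans (add_le_add b1 b2')))).trans ?_)
  have hcard : (0 : ℝ) ≤ ((box L).card : ℝ) := Nat.cast_nonneg _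
  have f1 : 0 ≤ 3 * M ^ 2 * Z := by positivity
  have f2 : 0 ≤ (box L).card * (36 * C * M ^ 4) * Z := by positivity
  unfold growthConst
  rw [← hL]
  have f3 : 3 * L * M ^ 2 * Z = 36 * C * M ^ 4 * Z := by rw [hL]; ring
  rw [f3]
  nlinarith [mul_nonneg f1 hl, mul_nonneg f2 hl]

end NormalForm

section TimeStep

variable {s T C M : ℝ} {v w : ℝ → ℤ → ℂ}

theorem pairBound_of_halfBound {v w : ℤ → ℂ} {Z : ℝ} (hM : 1 ≤ M)
    (hu : HalfBound M fun k => ‖v k‖ + ‖w k‖) (hZ : ∀ k, ‖v k - w k‖ ≤ Z) :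
    PairBound M Z (fun k => ‖v k‖ + ‖w k‖) v w where
  one_le := hM
  nonneg := (norm_nonneg _).trans (hZ 0)
  half := hu
  left _ := le_add_of_nonneg_right (norm_nonneg _)
  right _ := le_add_of_nonneg_left (norm_nonneg _)
  sub_le _ := norm_sub_le _ _
  sup := hZ

theorem norm_sub_le_of_norm_sub_le (hC : Admissible C) (hM : 1 ≤ M) (hv : IsSolution s T v)
    (hw : IsSolution s T w)
    (hu : ∀ t ∈ Set.Icc 0 T, HalfBound M fun k => ‖v t k‖ + ‖w t k‖) {t₀ t₁ n l G : ℝ}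
    (h0 : 0 ≤ t₀) (h1 : t₁ ≤ T) (heq : v t₀ = w t₀) (hn : 0 ≤ n)
    (hl : l = 4 * (growthConst C M * (2 * (1 + n))))
    (hG : ∀ t ∈ Set.Icc t₀ t₁, ∀ k, ‖v t k - w t k‖ ≤ G * Real.exp (l * (t - t₀))) :
    ∀ t ∈ Set.Icc t₀ t₁, ∀ k, ‖v t k - w t k‖ ≤
      (G / 2 + 12 * C ^ 2 * M ^ 5 * Real.exp (-(n / 12)) * (t₁ - t₀)) *
        Real.exp (l * (t - t₀)) := by
  intro t ht k
  have hM0 : 0 < M := zero_lt_one.trans_le hM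
  have hC0 := hC.pos
  have hg := growthConst_pos hC0 hM
  have hl0 : 0 < l := by rw [hl]; positivity
  have hT : ∀ x ∈ Set.Icc t₀ t₁, x ∈ Set.Icc 0 T := fun x hx => ⟨h0.trans hx.1, hx.2.trans h1⟩
  have hexp : 1 ≤ Real.exp (l * (t - t₀)) :=
    Real.one_le_exp (mul_nonneg hl0.le (by linarith [ht.1]))
  have ht01 : 0 ≤ t₁ - t₀ := by linarith [ht.1, ht.2]
  refine le_of_forall_pos_le_add fun ε hε => ?_
  obtain ⟨K, hK, hKε⟩ : ∃ K > 0,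
      |(k : ℝ)| * (2 * C * M ^ 3 * K ^ (-(1 / 12) : ℝ)) * (t₁ - t₀) < ε := by
    have h := ((((tendsto_rpow_neg_atTop (y := 1 / 12) (by norm_num)).const_mul
      (2 * C * M ^ 3)).const_mul |(k : ℝ)|).mul_const (t₁ - t₀))
    rw [mul_zero, mul_zero, zero_mul] at h
    obtain ⟨K, h2, h3⟩ := ((h.eventually_lt_const hε).and (Filter.eventually_gt_atTop 0)).exists
    exact ⟨K, h3, h2⟩
  obtain ⟨δ, hδ⟩ : ∃ δ, δ = |(k : ℝ)| * (2 * C * M ^ 3 * K ^ (-(1 / 12) : ℝ)) := ⟨_, rfl⟩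
  obtain ⟨e, he⟩ : ∃ e, e = 12 * C ^ 2 * M ^ 5 * Real.exp (-(n / 12)) := ⟨_, rfl⟩
  have hδ0 : 0 ≤ δ := by rw [hδ]; positivity
  have he0 : 0 ≤ e := by rw [he]; positivity
  rw [← hδ] at hKε
  rw [← he]
  have hex := fun x (hx : x ∈ Set.Icc 0 T) =>
    exists_hasDerivWithinAt_normalForm hC hv hw hK k hx (M := M)
  choose! y' hy' hbound using hex
  have hpair : ∀ x ∈ Set.Icc t₀ t₁, PairBound M (G * Real.exp (l * (x - t₀)))
      (fun k => ‖v x k‖ + ‖w x k‖) (v x) (w x) := fun x hx =>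
    pairBound_of_halfBound hM (hu x (hT x hx)) (hG x hx)
  have hmem : t₀ ∈ Set.Icc t₀ t₁ := ⟨le_rfl, by linarith⟩
  have hinit : normalForm K (12 * C * M ^ 2) v w k t₀ = 0 := by
    have h := norm_sub_normalForm_le (K := K) hC
      (pairBound_of_halfBound (Z := 0) hM (hu t₀ (hT _ hmem)) fun k => by simp [heq]) k
    simpa [heq] using h
  have hB : ∀ x, HasDerivAt (fun x => G / 4 * Real.exp (l * (x - t₀)) + (e + δ) * (x - t₀))
      (G / 4 * (Real.exp (l * (x - t₀)) * l) + (e + δ)) x := by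
    intro x
    have h1 : HasDerivAt (fun x => x - t₀) 1 x := (hasDerivAt_id x).sub_const t₀
    have h2 := (h1.const_mul l).exp
    rw [mul_one] at h2
    simpa using (h2.const_mul (G / 4)).fun_add (h1.const_mul (e + δ))
  have hG0 : 0 ≤ G := by
    have := (hpair t ht).nonneg
    exact nonneg_of_mul_nonneg_left this (Real.exp_pos _)
  have hy : ‖normalForm K (12 * C * M ^ 2) v w k t‖ ≤
      G / 4 * Real.exp (l * (t - t₀)) + (e + δ) * (t - t₀) := by
    refine image_norm_le_of_norm_deriv_right_le_deriv_boundary (f' := y')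
      (fun x hx => ((hy' x (hT x hx)).continuousWithinAt.mono fun z hz => hT z hz))
      (fun x hx => ?_) ?_ hB (fun x hx => ?_) ht
    · have hx' := hT x ⟨hx.1, hx.2.le⟩
      exact (hy' x hx').mono_of_mem_nhdsWithin (Filter.mem_of_superset
        (Icc_mem_nhdsGE (hx.2.trans_le h1)) fun z hz => ⟨hx'.1.trans hz.1, hz.2⟩)
    · rw [hinit, norm_zero]
      simp only [sub_self, mul_zero, add_zero, Real.exp_zero, mul_one]
      linarith
    · have hx' : x ∈ Set.Icc t₀ t₁ := ⟨hx.1, hx.2.le⟩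
      refine (hbound x (hT x hx') _ (Real.exp n) _ (Real.one_le_exp hn) (hpair x hx')).trans
        (le_of_eq ?_)
      rw [Real.log_exp, ← Real.exp_mul, ← hδ, he, hl]
      have : n * -(1 / 12) = -(n / 12) := by ring
      rw [this]
      ring
  have hz : ‖v t k - w t k‖ ≤ G * Real.exp (l * (t - t₀)) / 4 +
      (G / 4 * Real.exp (l * (t - t₀)) + (e + δ) * (t - t₀)) := by
    have := norm_add_le (v t k - w t k - normalForm K (12 * C * M ^ 2) v w k t)
      (normalForm K (12 * C * M ^ 2) v w k t)
    rw [sub_add_cancel] at this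
    exact this.trans (add_le_add (norm_sub_normalForm_le hC (hpair t ht) k) hy)
  have hd : δ * (t - t₀) ≤ δ * (t₁ - t₀) := by
    have := ht.2
    gcongr
  have hee : e * (t - t₀) ≤ e * (t₁ - t₀) * Real.exp (l * (t - t₀)) := by
    have := ht.2
    calc e * (t - t₀) ≤ e * (t₁ - t₀) := by gcongr
      _ ≤ _ := le_mul_of_one_le_right (by positivity) hexp
  linarith

/-- Uniqueness on a time interval whose length depends only on the size of the solutions. -/
theorem eq_of_sub_le (hC : Admissible C) (hM : 1 ≤ M) (hv : IsSolution s T v)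
    (hw : IsSolution s T w)
    (hu : ∀ t ∈ Set.Icc 0 T, HalfBound M fun k => ‖v t k‖ + ‖w t k‖) {t₀ t₁ : ℝ}
    (h0 : 0 ≤ t₀) (h1 : t₁ ≤ T) (heq : v t₀ = w t₀)
    (hτ : t₁ - t₀ ≤ 1 / (192 * growthConst C M)) :
    ∀ t ∈ Set.Icc t₀ t₁, v t = w t := by
  intro t ht
  ext k
  have hM0 : 0 < M := zero_lt_one.trans_le hM
  have hg := growthConst_pos hC.pos hM
  have ht01 : 0 ≤ t₁ - t₀ := by linarith [ht.1, ht.2]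
  obtain ⟨b, hb⟩ : ∃ b, b = 12 * C ^ 2 * M ^ 5 * (t₁ - t₀) := ⟨_, rfl⟩
  have hb0 : 0 ≤ b := by rw [hb]; positivity
  have hbd : ∀ n : ℝ, 0 ≤ n → ‖v t k - w t k‖ ≤ 2 * b * Real.exp ((1 - n) / 24) := by
    intro n hn
    obtain ⟨l, hl⟩ : ∃ l, l = 4 * (growthConst C M * (2 * (1 + n))) := ⟨_, rfl⟩
    have hl0 : 0 < l := by rw [hl]; positivity
    have hit : ∀ j : ℕ, ∀ x ∈ Set.Icc t₀ t₁, ∀ k, ‖v x k - w x k‖ ≤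
        (M / 2 ^ j + 2 * (b * Real.exp (-(n / 12)))) * Real.exp (l * (x - t₀)) := by
      intro j
      induction j with
      | zero =>
        intro x hx k
        have hexp : 1 ≤ Real.exp (l * (x - t₀)) :=
          Real.one_le_exp (mul_nonneg hl0.le (by linarith [hx.1]))
        have := (norm_sub_le (v x k) (w x k)).trans
          ((hu x ⟨h0.trans hx.1, hx.2.trans h1⟩).le hM0.le k)
        have hpos : 0 ≤ 2 * (b * Real.exp (-(n / 12))) := by positivity
        rw [pow_zero, div_one]
        nlinarith
      | succ j ih =>
        intro x hx k
        refine (norm_sub_le_of_norm_sub_le hC hM hv hw hu h0 h1 heq hn hl ih x hx k).trans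
          (le_of_eq ?_)
        rw [hb, pow_succ]
        field_simp
        ring
    have hlim : Filter.Tendsto (fun j : ℕ => (M / 2 ^ j + 2 * (b * Real.exp (-(n / 12)))) *
        Real.exp (l * (t - t₀))) Filter.atTop
        (nhds ((0 + 2 * (b * Real.exp (-(n / 12)))) * Real.exp (l * (t - t₀)))) := by
      refine ((Filter.Tendsto.add_const _ ?_)).mul_const _
      have := (tendsto_pow_atTop_nhds_zero_of_lt_one (r := (1 / 2 : ℝ)) (by norm_num)
        (by norm_num)).const_mul M
      simpa [div_eq_mul_inv] using this
    refine (ge_of_tendsto' hlim fun j => hit j t ht k).trans ?_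
    rw [zero_add, mul_assoc, mul_assoc, ← Real.exp_add, mul_assoc]
    gcongr
    have hlt : l * (t - t₀) ≤ l * (1 / (192 * growthConst C M)) := by
      have := ht.2
      gcongr
      linarith
    have hle : l * (1 / (192 * growthConst C M)) = (1 + n) / 24 := by
      rw [hl]
      field_simp
      ring
    linarith
  have hlim : Filter.Tendsto (fun n : ℝ => 2 * b * Real.exp ((1 - n) / 24)) Filter.atTop
      (nhds (2 * b * 0)) := by
    refine Filter.Tendsto.const_mul _ (Real.tendsto_exp_atBot.comp ?_)
    exact (Filter.tendsto_atBot_add_const_left _ (1 : ℝ)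
      Filter.tendsto_neg_atTop_atBot).atBot_div_const (by norm_num)
  have hle := ge_of_tendsto hlim ((Filter.eventually_ge_atTop 0).mono hbd)
  rw [mul_zero] at hle
  exact sub_eq_zero.1 (norm_le_zero_iff.1 hle)

theorem eq_of_halfBound (hC : Admissible C) (hM : 1 ≤ M) (hv : IsSolution s T v)
    (hw : IsSolution s T w)
    (hu : ∀ t ∈ Set.Icc 0 T, HalfBound M fun k => ‖v t k‖ + ‖w t k‖) (heq : v 0 = w 0) :
    ∀ t ∈ Set.Icc 0 T, v t = w t := by
  have hg := growthConst_pos hC.pos hM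
  obtain ⟨τ, hτ⟩ : ∃ τ, τ = 1 / (192 * growthConst C M) := ⟨_, rfl⟩
  have hτ0 : 0 < τ := by rw [hτ]; positivity
  have key : ∀ n : ℕ, ∀ t ∈ Set.Icc 0 T, t ≤ n * τ → v t = w t := by
    intro n
    induction n with
    | zero =>
      intro t ht htn
      have : t = 0 := le_antisymm (by simpa using htn) ht.1
      rw [this, heq]
    | succ n ih =>
      intro t ht htn
      rcases le_total t (n * τ) with h | h
      · exact ih t ht h
      · have hn0 : 0 ≤ n * τ := by positivity
        refine eq_of_sub_le hC hM hv hw hu hn0 ht.2 (ih _ ⟨hn0, h.trans ht.2⟩ le_rfl) ?_ t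
          ⟨h, le_rfl⟩
        rw [← hτ]
        push_cast at htn
        linarith
  intro t ht
  obtain ⟨n, hn⟩ := exists_nat_ge (t / τ)
  exact key n t ht ((div_le_iff₀ hτ0).1 hn)

end TimeStep

theorem HalfBound.mono {M N : ℝ} {f g : ℤ → ℝ} (hf : HalfBound M f) (hM : 0 ≤ M) (hMN : M ≤ N)
    (hg : ∀ k, 0 ≤ g k) (hgf : ∀ k, g k ≤ f k) : HalfBound N g := by
  refine ⟨hg, fun S => (Finset.sum_le_sum fun k _ => ?_).trans
    ((hf.2 S).trans (pow_le_pow_left₀ hM hMN 2))⟩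
  exact mul_le_mul_of_nonneg_left (pow_le_pow_left₀ (hg k) (hgf k) 2) (jb_pos k).le

theorem halfBound_of_hnorm_le {s N : ℝ} (hs : 1 / 2 ≤ s) (hN : 0 ≤ N) {f : ℤ → ℂ}
    (h : hnorm s f ≤ ENNReal.ofReal N) : HalfBound N fun k => ‖f k‖ := by
  refine ⟨fun k => norm_nonneg _, fun S => ?_⟩
  have h0 : ∀ k, 0 ≤ jb k ^ (2 * s) * ‖f k‖ ^ 2 := fun k =>
    mul_nonneg (Real.rpow_nonneg (jb_pos k).le _) (sq_nonneg _)
  have h2 : ∑' k : ℤ, ENNReal.ofReal (jb k ^ (2 * s) * ‖f k‖ ^ 2) ≤ ENNReal.ofReal (N ^ 2) := by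
    rw [hnorm, one_div, ENNReal.rpow_inv_le_iff two_pos,
      ENNReal.ofReal_rpow_of_nonneg hN two_pos.le] at h
    simpa using h
  have h3 := (ENNReal.sum_le_tsum S).trans h2
  rw [← ENNReal.ofReal_sum_of_nonneg fun k _ => h0 k,
    ENNReal.ofReal_le_ofReal_iff (sq_nonneg N)] at h3
  refine (Finset.sum_le_sum fun k _ => ?_).trans h3
  refine mul_le_mul_of_nonneg_right ?_ (sq_nonneg _)
  exact Real.self_le_rpow_of_one_le (one_le_jb k) (by linarith)

theorem IsSolution.exists_halfBound {s T : ℝ} {v : ℝ → ℤ → ℂ} (hs : 1 / 2 ≤ s)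
    (hv : IsSolution s T v) :
    ∃ N : ℝ, 0 ≤ N ∧ ∀ t ∈ Set.Icc 0 T, HalfBound N fun k => ‖v t k‖ := by
  refine (isCompact_Icc (a := (0 : ℝ)) (b := T)).induction_on
    (p := fun S => ∃ N : ℝ, 0 ≤ N ∧ ∀ t ∈ S, HalfBound N fun k => ‖v t k‖)
    ⟨0, le_rfl, fun t ht => ht.elim⟩ ?_ ?_ ?_
  · rintro S S' hS ⟨N, hN, h⟩
    exact ⟨N, hN, fun t ht => h t (hS ht)⟩
  · rintro S S' ⟨N, hN, h⟩ ⟨N', hN', h'⟩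
    refine ⟨max N N', hN.trans (le_max_left _ _), fun t ht => ?_⟩
    rcases ht with ht | ht
    · exact (h t ht).mono hN (le_max_left _ _) (fun _ => norm_nonneg _) fun _ => le_rfl
    · exact (h' t ht).mono hN' (le_max_right _ _) (fun _ => norm_nonneg _) fun _ => le_rfl
  · intro x hx
    obtain ⟨δ, hδ, h⟩ := hv.cont x hx 1 one_pos
    refine ⟨Set.Icc 0 T ∩ Metric.ball x δ, Filter.inter_mem self_mem_nhdsWithin
      (mem_nhdsWithin_of_mem_nhds (Metric.ball_mem_nhds x hδ)), ?_⟩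
    obtain ⟨N, hN⟩ : ∃ N, N = (hnorm s (v x)).toReal := ⟨_, rfl⟩
    have hN0 : 0 ≤ N := by rw [hN]; exact ENNReal.toReal_nonneg
    have hvx : HalfBound N fun k => ‖v x k‖ := halfBound_of_hnorm_le hs hN0 (by
      rw [hN, ENNReal.ofReal_toReal (hv.finite x hx).ne])
    refine ⟨2 * (1 + N), by positivity, fun t ht => ?_⟩
    have hvt := halfBound_of_hnorm_le hs zero_le_one
      (h t ht.1 (by simpa [Real.dist_eq] using ht.2)).le
    refine (hvt.add zero_le_one hN0 hvx).mono (by positivity) le_rfl (fun _ => norm_nonneg _)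
      fun k => ?_
    simpa using norm_add_le (v t k - v x k) (v x k)

/-- Unconditional uniqueness of periodic mKdV in `H^s`, `s ≥ 1/2`. -/
theorem unconditional_uniqueness (s : ℝ) (hs : 1 / 2 ≤ s) (T : ℝ) (hT : 0 < T)
    (v w : ℝ → ℤ → ℂ) (hv : IsSolution s T v) (hw : IsSolution s T w)
    (h0 : v 0 = w 0) :
    ∀ t ∈ Set.Icc (0 : ℝ) T, v t = w t := by
  obtain ⟨C, hC⟩ := exists_admissible
  obtain ⟨N, hN, hvN⟩ := hv.exists_halfBound hs
  obtain ⟨N', hN', hwN⟩ := hw.exists_halfBound hs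
  have hM : 1 ≤ 1 + 2 * (N + N') := by linarith
  refine eq_of_halfBound hC hM hv hw (fun t ht => ?_) h0
  have h := (hvN t ht).add hN hN' (hwN t ht)
  exact h.mono (by positivity) (by linarith) h.1 fun _ => le_rfl
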